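/- arXiv:math/9903200 — 2 statements merged into one kernel-verified Lean document; each statement's English description precedes it below -/
import Mathlib

section
/- Let 2 ≤ n ≤ 4 and let K and L be origin-symmetric convex bodies in ℝⁿ such that vol_{n−1}(K ∩ ξ^⊥) ≤ vol_{n−1}(L ∩ ξ^⊥) for every ξ ∈ S^{n−1}, where ξ^⊥ = {x ∈ ℝⁿ : ⟨x,ξ⟩ = 0} and vol_{n−1} denotes (n−1)-dimensional Hausdorff measure. Then vol_n(K) ≤ vol_n(L), where vol_n denotes Lebesgue measure on ℝⁿ. (Affirmative answer to the Busemann–Petty problem for n ≤ 4.) -/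
open MeasureTheory Set
open scoped RealInnerProductSpace ENNReal


/-- Prékopa–Leindler property of a measure. -/
def BPPL {X : Type*} [AddCommGroup X] [Module ℝ X] [MeasurableSpace X] (μ : Measure X) : Prop :=
  ∀ (a b : ℝ), 0 < a → 0 < b → a + b = 1 → ∀ f g h : X → ℝ≥0∞, Measurable f → Measurable g →
    Measurable h → (∀ x y, f x ^ a * g y ^ b ≤ h (a • x + b • y)) →
    (∫⁻ x, f x ∂μ) ^ a * (∫⁻ x, g x ∂μ) ^ b ≤ ∫⁻ x, h x ∂μ

lemma bp_bm_compact {A B C : Set ℝ} (hA : IsCompact A) (hB : IsCompact B) (hA0 : A.Nonempty)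
    (hB0 : B.Nonempty) (h : ∀ x ∈ A, ∀ y ∈ B, x + y ∈ C) :
    volume A + volume B ≤ volume C := by
  have h1 : sSup A ∈ A := hA.sSup_mem hA0
  have h2 : sInf B ∈ B := hB.sInf_mem hB0
  have e1 : volume A = volume ((fun x => sInf B + x) '' A) := by
    simp [image_add_left, measure_preimage_add]
  have e2 : volume B = volume ((fun x => sSup A + x) '' B) := by
    simp [image_add_left, measure_preimage_add]
  rw [e1, e2, ← measure_union₀]
  · apply measure_mono
    rintro z (⟨x, hx, rfl⟩ | ⟨x, hx, rfl⟩)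
    · simpa [add_comm] using h x hx _ h2
    · exact h _ h1 x hx
  · exact ((hB.image (by fun_prop)).measurableSet).nullMeasurableSet
  · have : ((fun x => sInf B + x) '' A) ∩ ((fun x => sSup A + x) '' B) ⊆ {sSup A + sInf B} := by
      rintro z ⟨⟨x, hx, rfl⟩, ⟨y, hy, hxy⟩⟩
      have a1 : x ≤ sSup A := le_csSup hA.bddAbove hx
      have a2 : sInf B ≤ y := csInf_le hB.bddBelow hy
      simp only [mem_singleton_iff]
      simp only at hxy
      linarith
    exact measure_mono_null this (by simp)

lemma bp_bm {A B C : Set ℝ} (hA : MeasurableSet A) (hB : MeasurableSet B) (hA0 : A.Nonempty)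
    (hB0 : B.Nonempty) (h : ∀ x ∈ A, ∀ y ∈ B, x + y ∈ C) :
    volume A + volume B ≤ volume C := by
  obtain ⟨x0, hx0⟩ := hA0
  obtain ⟨y0, hy0⟩ := hB0
  rw [hA.measure_eq_iSup_isCompact, hB.measure_eq_iSup_isCompact]
  simp only [iSup_and']
  refine ENNReal.biSup_add_biSup_le' (p := fun K : Set ℝ => K ⊆ A ∧ IsCompact K)
    (q := fun K : Set ℝ => K ⊆ B ∧ IsCompact K) ⟨∅, by simp⟩ ⟨∅, by simp⟩ ?_
  rintro K ⟨hK, hKc⟩ K' ⟨hK', hKc'⟩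
  refine le_trans (add_le_add (measure_mono (subset_insert x0 K))
    (measure_mono (subset_insert y0 K'))) ?_
  apply bp_bm_compact (hKc.insert x0) (hKc'.insert y0) (insert_nonempty _ _) (insert_nonempty _ _)
  intro x hx y hy
  refine h x ?_ y ?_
  · rcases hx with rfl | hx
    exacts [hx0, hK hx]
  · rcases hy with rfl | hy
    exacts [hy0, hK' hy]

lemma bp_bm' {A B C : Set ℝ} {a b : ℝ} (ha : 0 < a) (hb : 0 < b) (hA : MeasurableSet A)
    (hB : MeasurableSet B) (hA0 : A.Nonempty)
    (hB0 : B.Nonempty) (h : ∀ x ∈ A, ∀ y ∈ B, a * x + b * y ∈ C) :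
    ENNReal.ofReal a * volume A + ENNReal.ofReal b * volume B ≤ volume C := by
  have e1 : ∀ {c : ℝ} (hc : 0 < c) (S : Set ℝ), ENNReal.ofReal c * volume S
      = volume ((fun x => c * x) '' S) := by
    intro c hc S
    have := Measure.addHaar_smul (volume : Measure ℝ) c S
    rw [Module.finrank_self, pow_one, abs_of_pos hc] at this
    rw [← this]
    rfl
  rw [e1 ha, e1 hb]
  apply bp_bm
  · exact (measurableEmbedding_mulLeft₀ ha.ne').measurableSet_image.2 hA
  · exact (measurableEmbedding_mulLeft₀ hb.ne').measurableSet_image.2 hB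
  · exact hA0.image _
  · exact hB0.image _
  · rintro _ ⟨x, hx, rfl⟩ _ ⟨y, hy, rfl⟩
    exact h x hx y hy

lemma bp_layer (f : ℝ → ℝ≥0∞) (hf : Measurable f) (h1 : ∀ x, f x ≤ 1) :
    ∫⁻ x, f x = ∫⁻ u in Ioo (0:ℝ) 1, volume {x | ENNReal.ofReal u < f x} := by
  have e : ∀ x, ENNReal.ofReal (f x).toReal = f x := fun x =>
    ENNReal.ofReal_toReal ((h1 x).trans_lt ENNReal.one_lt_top).ne
  have := lintegral_eq_lintegral_meas_lt (volume : Measure ℝ) (f := fun x => (f x).toReal)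
    (Filter.Eventually.of_forall fun x => ENNReal.toReal_nonneg) hf.ennreal_toReal.aemeasurable
  simp only [e] at this
  rw [this]
  have e2 : ∀ u ∈ Ioi (0:ℝ), volume {x | u < (f x).toReal}
      = (Ioo (0:ℝ) 1).indicator (fun u => volume {x | ENNReal.ofReal u < f x}) u := by
    intro u hu
    have e3 : {x | u < (f x).toReal} = {x | ENNReal.ofReal u < f x} := by
      ext x
      simp only [mem_ofPred_eq]
      conv_rhs => rw [← e x]
      rw [ENNReal.ofReal_lt_ofReal_iff_of_nonneg (le_of_lt hu)]
    by_cases h : u < 1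
    · rw [indicator_of_mem (show u ∈ Ioo (0:ℝ) 1 from ⟨hu, h⟩), e3]
    · rw [indicator_of_notMem (fun hh => h hh.2)]
      rw [e3]
      convert measure_empty (μ := (volume : Measure ℝ))
      ext x
      simp only [mem_ofPred_eq, mem_empty_iff_false, iff_false, not_lt]
      refine (h1 x).trans ?_
      rw [← ENNReal.ofReal_one]
      exact ENNReal.ofReal_le_ofReal (not_lt.1 h)
  rw [setLIntegral_congr_fun measurableSet_Ioi e2, lintegral_indicator measurableSet_Ioo,
    Measure.restrict_restrict measurableSet_Ioo]
  congr 2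
  ext x
  simp +contextual

lemma bp_pl_norm {a b : ℝ} (ha : 0 < a) (hb : 0 < b) (hab : a + b = 1) (f g h : ℝ → ℝ≥0∞)
    (hf : Measurable f) (hg : Measurable g) (hh : Measurable h) (hf1 : ⨆ x, f x = 1)
    (hg1 : ⨆ x, g x = 1) (H : ∀ x y, f x ^ a * g y ^ b ≤ h (a * x + b * y)) :
    ENNReal.ofReal a * (∫⁻ x, f x) + ENNReal.ofReal b * ∫⁻ x, g x ≤ ∫⁻ x, h x := by
  have hf' : ∀ x, f x ≤ 1 := fun x => hf1 ▸ le_iSup f x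
  have hg' : ∀ x, g x ≤ 1 := fun x => hg1 ▸ le_iSup g x
  refine le_trans ?_ (lintegral_mono (fun x => min_le_left (h x) 1))
  rw [bp_layer f hf hf', bp_layer g hg hg', bp_layer _ (hh.min measurable_const)
    (fun x => min_le_right _ _)]
  have mm : ∀ f : ℝ → ℝ≥0∞, Measurable (fun u : ℝ => volume {x | ENNReal.ofReal u < f x}) := by
    intro f
    apply Antitone.measurable
    intro u v huv
    exact measure_mono fun x hx => (ENNReal.ofReal_le_ofReal huv).trans_lt hx
  rw [← lintegral_const_mul _ (mm f), ← lintegral_const_mul _ (mm g),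
    ← lintegral_add_left ((mm f).const_mul _)]
  apply setLIntegral_mono' measurableSet_Ioo
  rintro u ⟨hu0, hu1⟩
  have hu1' : ENNReal.ofReal u < 1 := by
    rw [← ENNReal.ofReal_one]; exact (ENNReal.ofReal_lt_ofReal_iff one_pos).2 hu1
  apply bp_bm' ha hb (measurableSet_lt measurable_const hf) (measurableSet_lt measurable_const hg)
  · rw [← hf1] at hu1'
    exact lt_iSup_iff.1 hu1'
  · rw [← hg1] at hu1'
    exact lt_iSup_iff.1 hu1'
  · intro x hx y hy
    simp only [mem_ofPred_eq] at hx hy ⊢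
    refine lt_min (lt_of_lt_of_le ?_ (H x y)) hu1'
    have : ENNReal.ofReal u = ENNReal.ofReal u ^ a * ENNReal.ofReal u ^ b := by
      rw [← ENNReal.rpow_add _ _ (by simpa using hu0) (by simp), hab, ENNReal.rpow_one]
    rw [this]
    exact ENNReal.mul_lt_mul (ENNReal.rpow_lt_rpow hx ha) (ENNReal.rpow_lt_rpow hy hb)

lemma bp_amgm {a b : ℝ} (ha : 0 < a) (hb : 0 < b) (hab : a + b = 1) (x y : ℝ≥0∞) :
    x ^ a * y ^ b ≤ ENNReal.ofReal a * x + ENNReal.ofReal b * y := by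
  have := ENNReal.young_inequality (x ^ a) (y ^ b) (p := a⁻¹) (q := b⁻¹)
    (Real.holderConjugate_iff.2 ⟨(one_lt_inv₀ ha).2 (by linarith), by simpa using hab⟩)
  rw [← ENNReal.rpow_mul, ← ENNReal.rpow_mul, mul_inv_cancel₀ ha.ne', mul_inv_cancel₀ hb.ne',
    ENNReal.rpow_one, ENNReal.rpow_one, ENNReal.ofReal_inv_of_pos ha, ENNReal.ofReal_inv_of_pos hb,
    div_eq_mul_inv, div_eq_mul_inv, inv_inv, inv_inv] at this
  rwa [mul_comm _ x, mul_comm _ y]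

lemma bp_pl_bdd {a b : ℝ} (ha : 0 < a) (hb : 0 < b) (hab : a + b = 1) (f g h : ℝ → ℝ≥0∞)
    (hf : Measurable f) (hg : Measurable g) (hh : Measurable h) (hf1 : ⨆ x, f x ≠ ∞)
    (hg1 : ⨆ x, g x ≠ ∞) (H : ∀ x y, f x ^ a * g y ^ b ≤ h (a * x + b * y)) :
    (∫⁻ x, f x) ^ a * (∫⁻ x, g x) ^ b ≤ ∫⁻ x, h x := by
  set F := ⨆ x, f x with hF
  set G := ⨆ x, g x with hG
  by_cases hF0 : F = 0
  · have : ∀ x, f x = 0 := fun x => le_antisymm (hF0 ▸ le_iSup f x) bot_le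
    simp [this, ENNReal.zero_rpow_of_pos ha]
  by_cases hG0 : G = 0
  · have : ∀ x, g x = 0 := fun x => le_antisymm (hG0 ▸ le_iSup g x) bot_le
    simp [this, ENNReal.zero_rpow_of_pos hb]
  have key := bp_pl_norm ha hb hab (fun x => F⁻¹ * f x) (fun x => G⁻¹ * g x)
    (fun x => (F ^ a)⁻¹ * (G ^ b)⁻¹ * h x) (hf.const_mul _) (hg.const_mul _) (hh.const_mul _)
    (by rw [← ENNReal.mul_iSup, ← hF, ENNReal.inv_mul_cancel hF0 hf1])
    (by rw [← ENNReal.mul_iSup, ← hG, ENNReal.inv_mul_cancel hG0 hg1])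
    (by
      intro x y
      rw [ENNReal.mul_rpow_of_nonneg _ _ ha.le, ENNReal.mul_rpow_of_nonneg _ _ hb.le,
        ENNReal.inv_rpow, ENNReal.inv_rpow, mul_mul_mul_comm]
      gcongr
      exact H x y)
  have k2 := (bp_amgm ha hb hab _ _).trans key
  rw [lintegral_const_mul _ hf, lintegral_const_mul _ hg, lintegral_const_mul _ hh,
    ENNReal.mul_rpow_of_nonneg _ _ ha.le, ENNReal.mul_rpow_of_nonneg _ _ hb.le,
        ENNReal.inv_rpow, ENNReal.inv_rpow, mul_mul_mul_comm] at k2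
  have hFa : F ^ a ≠ 0 := by simp [hF0, hf1]
  have hFa' : F ^ a ≠ ∞ := by simp [hF0, hf1]
  have hGa : G ^ b ≠ 0 := by simp [hG0, hg1]
  have hGa' : G ^ b ≠ ∞ := by simp [hG0, hg1]
  refine (ENNReal.mul_le_mul_iff_right (a := (F ^ a)⁻¹ * (G ^ b)⁻¹) ?_ ?_).1 k2
  · simp [hFa', hGa', -ENNReal.rpow_eq_top_iff]
  · exact ENNReal.mul_ne_top (by simp [hFa, -ENNReal.rpow_eq_zero_iff])
      (by simp [hGa, -ENNReal.rpow_eq_zero_iff])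

lemma bp_pl_real : BPPL (volume : Measure ℝ) := by
  intro a b ha hb hab f g h hf hg hh H
  have lim : ∀ f : ℝ → ℝ≥0∞, Measurable f → Filter.Tendsto (fun n : ℕ => ∫⁻ x, min (f x) n)
      Filter.atTop (nhds (∫⁻ x, f x)) := by
    intro f hf
    apply lintegral_tendsto_of_tendsto_of_monotone
    · intro n; exact (hf.min measurable_const).aemeasurable
    · refine Filter.Eventually.of_forall fun x n m hnm => ?_
      simp only
      gcongr
    · refine Filter.Eventually.of_forall fun x => ?_
      have : Filter.Tendsto (fun n : ℕ => min (f x) (n : ℝ≥0∞)) Filter.atTop (nhds (min (f x) ∞)) :=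
        tendsto_const_nhds.min ENNReal.tendsto_nat_nhds_top
      simpa using this
  have ev : ∀ n : ℕ, (∫⁻ x, min (f x) n) ^ a ≤ (∫⁻ x, f x) ^ a := fun n => by
    gcongr; exact min_le_left _ _
  have main : ∀ n : ℕ, (∫⁻ x, min (f x) n) ^ a * (∫⁻ x, min (g x) n) ^ b ≤ ∫⁻ x, h x := by
    intro n
    apply bp_pl_bdd ha hb hab _ _ _ (hf.min measurable_const) (hg.min measurable_const) hh
    · exact ((iSup_le fun x => min_le_right _ _).trans_lt (ENNReal.natCast_lt_top n)).ne
    · exact ((iSup_le fun x => min_le_right _ _).trans_lt (ENNReal.natCast_lt_top n)).ne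
    · intro x y
      refine le_trans ?_ (H x y)
      gcongr <;> exact min_le_left _ _
  have mono : ∀ f : ℝ → ℝ≥0∞, Monotone (fun n : ℕ => ∫⁻ x, min (f x) n) := by
    intro f n m hnm
    apply lintegral_mono
    intro x
    simp only
    gcongr
  have hsup : ∀ f : ℝ → ℝ≥0∞, Measurable f → ∀ c : ℝ, 0 < c →
      (∫⁻ x, f x) ^ c = ⨆ n : ℕ, (∫⁻ x, min (f x) n) ^ c := by
    intro f hf c hc
    refine tendsto_nhds_unique ((ENNReal.continuous_rpow_const.tendsto _).comp (lim f hf)) ?_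
    apply tendsto_atTop_iSup
    intro n m hnm
    exact ENNReal.rpow_le_rpow (mono f hnm) hc.le
  rw [hsup f hf a ha, hsup g hg b hb, ENNReal.iSup_mul]
  refine iSup_le fun n => ?_
  rw [ENNReal.mul_iSup]
  refine iSup_le fun k => le_trans ?_ (main (max n k))
  exact mul_le_mul' (ENNReal.rpow_le_rpow (mono f (le_max_left _ _)) ha.le)
    (ENNReal.rpow_le_rpow (mono g (le_max_right _ _)) hb.le)

lemma bp_pl_prod {X Y : Type*} [AddCommGroup X] [Module ℝ X] [MeasurableSpace X]
    [AddCommGroup Y] [Module ℝ Y] [MeasurableSpace Y] {μ : Measure X} {ν : Measure Y}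
    [SFinite ν] [SFinite μ] (hμ : BPPL μ) (hν : BPPL ν) : BPPL (μ.prod ν) := by
  intro a b ha hb hab f g h hf hg hh H
  rw [lintegral_prod _ hf.aemeasurable, lintegral_prod _ hg.aemeasurable,
    lintegral_prod _ hh.aemeasurable]
  apply hμ a b ha hb hab _ _ _ hf.lintegral_prod_right' hg.lintegral_prod_right'
    hh.lintegral_prod_right'
  intro x y
  apply hν a b ha hb hab (fun u => f (x, u)) (fun u => g (y, u)) (fun u => h (a • x + b • y, u))
    (by fun_prop) (by fun_prop) (by fun_prop)
  intro u v
  exact H (x, u) (y, v)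

lemma bp_pl_map {X Y : Type*} [AddCommGroup X] [Module ℝ X] [MeasurableSpace X]
    [AddCommGroup Y] [Module ℝ Y] [MeasurableSpace Y] {μ : Measure X} {ν : Measure Y}
    (hμ : BPPL μ) (e : X → Y) (he : MeasurePreserving e μ ν)
    (hl : ∀ (a b : ℝ) x y, e (a • x + b • y) = a • e x + b • e y) : BPPL ν := by
  intro a b ha hb hab f g h hf hg hh H
  rw [← he.lintegral_comp hf, ← he.lintegral_comp hg, ← he.lintegral_comp hh]
  have := he.measurable
  apply hμ a b ha hb hab _ _ _ (by fun_prop) (by fun_prop) (by fun_prop)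
  intro x y
  rw [hl]
  exact H _ _

lemma bp_pl_pi (m : ℕ) : BPPL (volume : Measure (Fin m → ℝ)) := by
  induction m with
  | zero =>
    intro a b ha hb hab f g h hf hg hh H
    have hv : (volume : Measure (Fin 0 → ℝ)) = Measure.dirac default := by
      rw [volume_pi]; exact Measure.pi_of_empty _ _
    rw [hv, lintegral_dirac, lintegral_dirac, lintegral_dirac]
    convert H default default
  | succ m ih =>
    refine bp_pl_map (bp_pl_prod bp_pl_real ih) _
      (volume_preserving_piFinSuccAbove (fun _ : Fin (m+1) => ℝ) 0).symm ?_
    intro a b x y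
    ext i
    refine Fin.cases ?_ (fun i => ?_) i <;> simp [MeasurableEquiv.piFinSuccAbove]

lemma bp_pl_euc (m : ℕ) : BPPL (volume : Measure (EuclideanSpace ℝ (Fin m))) :=
  bp_pl_map (bp_pl_pi m) _ (PiLp.volume_preserving_toLp (Fin m)) (fun a b x y => by simp)



lemma bp_lc {A h : ℝ → ℝ} {C : ℝ} (hA : Measurable A) (hA0 : ∀ t, 0 ≤ A t)
    (hAanti : AntitoneOn A (Ioi 0)) (hAint : IntegrableOn A (Ioi 0)) (hh : Measurable h)
    (hC : ∀ t, |h t| ≤ C) (hpos : ∀ T, 0 ≤ T → 0 ≤ ∫ t in Ioc 0 T, h t) :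
    0 ≤ ∫ t in Ioi 0, A t * h t := by
  set μ := (volume : Measure ℝ).restrict (Ioi 0) with hμ
  set S : Set (ℝ × ℝ) := {p | p.2 < A p.1} with hS
  have hSm : MeasurableSet S := measurableSet_lt (by fun_prop) (by fun_prop)
  have hlen : ∀ t, μ {l | l < A t} = ENNReal.ofReal (A t) := by
    intro t
    rw [hμ, Measure.restrict_apply (show MeasurableSet {l | l < A t} from measurableSet_Iio)]
    have : {l | l < A t} ∩ Ioi 0 = Ioo 0 (A t) := by ext; simp [and_comm]
    rw [this]; simp
  have hfin : (μ.prod μ) S ≠ ∞ := by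
    rw [Measure.prod_apply hSm]
    have : ∀ t, μ (Prod.mk t ⁻¹' S) = ENNReal.ofReal (A t) := hlen
    simp_rw [this]
    exact ((hasFiniteIntegral_iff_ofReal (Filter.Eventually.of_forall hA0)).1 hAint.2).ne
  have hint : Integrable (fun p : ℝ × ℝ => S.indicator (fun p => h p.1) p) (μ.prod μ) := by
    rw [integrable_indicator_iff hSm]
    refine Measure.integrableOn_of_bounded (M := C) hfin (hh.comp measurable_fst).aestronglyMeasurable ?_
    exact Filter.Eventually.of_forall fun p => hC p.1
  have e1 : ∫ t in Ioi 0, A t * h t = ∫ t, ∫ l, S.indicator (fun p => h p.1) (t, l) ∂μ ∂μ := by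
    congr 1
    ext t
    have : (fun l => S.indicator (fun p => h p.1) (t, l)) = {l | l < A t}.indicator (fun _ => h t) := by
      ext l; simp [indicator, hS]
    rw [this, integral_indicator_const _ (show MeasurableSet {l | l < A t} from measurableSet_Iio), measureReal_def, hlen,
      ENNReal.toReal_ofReal (hA0 t), smul_eq_mul]
  rw [e1, integral_integral_swap hint]
  apply setIntegral_nonneg measurableSet_Ioi
  intro l hl
  have e2 : (fun t => S.indicator (fun p => h p.1) (t, l)) = {t | l < A t}.indicator h := by
    ext t; simp [indicator, hS]
  have hm : MeasurableSet {t | l < A t} := measurableSet_lt measurable_const hA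
  rw [e2, integral_indicator hm, hμ, Measure.restrict_restrict hm]
  set Q := {t | l < A t} ∩ Ioi 0 with hQ
  have hQd : ∀ t ∈ Q, ∀ s, 0 < s → s ≤ t → s ∈ Q := by
    rintro t ⟨ht, ht0⟩ s hs hst
    exact ⟨lt_of_lt_of_le ht (hAanti hs ht0 hst), hs⟩
  have hQv : volume Q ≠ ∞ := by
    have := Integrable.measure_gt_lt_top hAint hl
    rw [Measure.restrict_apply hm] at this
    exact this.ne
  have hbdd : BddAbove Q := by
    by_contra hb
    apply hQv
    rw [eq_top_iff, ← Real.volume_Ioi (a := 0)]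
    apply measure_mono
    intro s hs
    obtain ⟨t, ht, hst⟩ := not_bddAbove_iff.1 hb s
    exact hQd t ht s hs hst.le
  rcases Q.eq_empty_or_nonempty with he | hne
  · rw [he]; simp
  have hT : 0 ≤ sSup Q := Real.sSup_nonneg (fun x hx => le_of_lt hx.2)
  have s1 : Ioo 0 (sSup Q) ⊆ Q := by
    rintro s ⟨hs, hs'⟩
    obtain ⟨t, ht, hst⟩ := exists_lt_of_lt_csSup hne hs'
    exact hQd t ht s hs hst.le
  have s2 : Q ⊆ Ioc 0 (sSup Q) := fun t ht => ⟨ht.2, le_csSup hbdd ht⟩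
  have : Q =ᵐ[volume] Ioc 0 (sSup Q) := by
    refine Filter.EventuallyLE.antisymm s2.eventuallyLE ?_
    exact (Ioo_ae_eq_Ioc (a := (0:ℝ)) (b := sSup Q) (μ := volume)).symm.le.trans s1.eventuallyLE
  rw [setIntegral_congr_set this]
  exact hpos _ hT

section gauss
variable {V : Type*} [NormedAddCommGroup V] [InnerProductSpace ℝ V] [FiniteDimensional ℝ V]
  [MeasurableSpace V] [BorelSpace V]

lemma bp_gauss_int {b : ℝ} (hb : 0 < b) : Integrable (fun v : V => Real.exp (-b * ‖v‖ ^ 2)) := by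
  have := (GaussianFourier.integrable_cexp_neg_mul_sq_norm_add (V := V) (b := (b : ℂ))
    (by simpa using hb) 0 0).re
  refine this.congr (Filter.Eventually.of_forall fun v => ?_)
  simp only [zero_mul, add_zero]
  have : (-(b:ℂ) * (‖v‖:ℂ) ^ 2) = ((-b * ‖v‖^2 : ℝ) : ℂ) := by push_cast; ring
  simp only [this]
  exact Complex.exp_ofReal_re _

lemma bp_gauss_cos {b : ℝ} (hb : 0 < b) (y : V) :
    ∫ v : V, Real.exp (-b * ‖v‖ ^ 2) * Real.cos ⟪y, v⟫
      = (Real.pi / b) ^ ((Module.finrank ℝ V : ℝ) / 2) * Real.exp (-‖y‖ ^ 2 / (4 * b)) := by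
  have h1 := GaussianFourier.integral_cexp_neg_mul_sq_norm_add (V := V) (b := (b : ℂ))
    (by simpa using hb) Complex.I y
  have h2 := GaussianFourier.integrable_cexp_neg_mul_sq_norm_add (V := V) (b := (b : ℂ))
    (by simpa using hb) Complex.I y
  have h3 := congrArg Complex.re h1
  have h4 : (∫ v : V, Complex.exp (-b * ‖v‖ ^ 2 + Complex.I * (inner ℝ y v : ℝ))).re
      = ∫ v : V, (Complex.exp (-b * ‖v‖ ^ 2 + Complex.I * (inner ℝ y v : ℝ))).re :=
    (integral_re h2).symm
  rw [h4] at h3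
  rw [Complex.I_sq] at h3
  have e1 : ∀ v : V, (Complex.exp (-b * ‖v‖ ^ 2 + Complex.I * (inner ℝ y v : ℝ))).re
      = Real.exp (-b * ‖v‖ ^ 2) * Real.cos ⟪y, v⟫ := by
    intro v
    rw [Complex.exp_re]
    congr 2
    · simp [← Complex.ofReal_pow]
    · simp [← Complex.ofReal_pow]
  simp_rw [e1] at h3
  rw [h3]
  have e2 : ((Real.pi : ℂ) / b) ^ ((Module.finrank ℝ V : ℂ) / 2)
      = (((Real.pi / b) ^ ((Module.finrank ℝ V : ℝ) / 2) : ℝ) : ℂ) := by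
    rw [Complex.ofReal_cpow (by positivity)]
    push_cast; rfl
  have e3 : Complex.exp (-1 * (‖y‖:ℂ) ^ 2 / (4 * b)) = ((Real.exp (-‖y‖ ^ 2 / (4 * b)) : ℝ) : ℂ) := by
    push_cast; congr 1; ring
  rw [e2, e3, ← Complex.ofReal_mul, Complex.ofReal_re]
end gauss

lemma bp_gauss_cos_real {b : ℝ} (hb : 0 < b) (y : ℝ) :
    ∫ s : ℝ, Real.exp (-b * s ^ 2) * Real.cos (s * y)
      = (Real.pi / b) ^ ((1 : ℝ) / 2) * Real.exp (-y ^ 2 / (4 * b)) := by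
  have := bp_gauss_cos (V := ℝ) hb y
  simpa using this

lemma bp_w_int {a : ℝ} (ha : 0 < a) (k : ℕ) :
    Integrable (fun s : ℝ => |s| ^ k * Real.exp (-a * s ^ 2)) := by
  have h := integrable_rpow_mul_exp_neg_mul_sq ha (s := k) (by linarith [Nat.cast_nonneg (α := ℝ) k])
  have h2 := h.norm
  refine h2.congr (Filter.Eventually.of_forall fun s => ?_)
  simp [Real.rpow_natCast, Real.abs_exp]

lemma bp_kernel_prim {a : ℝ} (ha : 0 < a) {m : ℕ} (hm : m = 0 ∨ m = 1 ∨ m = 2) {T : ℝ} (hT : 0 ≤ T) :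
    0 ≤ ∫ t in Ioc 0 T, ∫ s : ℝ, |s| ^ m * Real.exp (-a * s ^ 2) * Real.cos (s * t) := by
  by_cases hm0 : m = 0
  · subst hm0
    apply setIntegral_nonneg measurableSet_Ioc
    intro t ht
    simp only [pow_zero, one_mul]
    rw [bp_gauss_cos_real ha]
    positivity
  have hint : Integrable (fun p : ℝ × ℝ => |p.2| ^ m * Real.exp (-a * p.2 ^ 2) * Real.cos (p.2 * p.1))
      ((volume.restrict (Ioc 0 T)).prod volume) := by
    have : Integrable (fun p : ℝ × ℝ => (1 : ℝ) * (|p.2| ^ m * Real.exp (-a * p.2 ^ 2)))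
        ((volume.restrict (Ioc 0 T)).prod volume) :=
      Integrable.mul_prod (f := fun _ => (1:ℝ)) (integrable_const _) (bp_w_int ha m)
    refine this.mono' (by fun_prop) (Filter.Eventually.of_forall fun p => ?_)
    rw [norm_mul, one_mul, Real.norm_of_nonneg (by positivity)]
    exact mul_le_of_le_one_right (by positivity) (Real.abs_cos_le_one _)
  rw [integral_integral_swap hint]
  have e1 : ∀ᵐ s : ℝ, ∫ t in Ioc 0 T, |s| ^ m * Real.exp (-a * s ^ 2) * Real.cos (s * t)
      = |s| ^ m * Real.exp (-a * s ^ 2) * (Real.sin (s * T) / s) := by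
    have : ∀ᵐ s : ℝ, s ≠ 0 := by simp [ae_iff]
    filter_upwards [this] with s hs
    rw [integral_const_mul]
    congr 1
    rw [← intervalIntegral.integral_of_le hT, intervalIntegral.integral_comp_mul_left _ hs]
    simp [div_eq_inv_mul]
  rw [integral_congr_ae e1]
  rcases hm with h | rfl | rfl
  · exact absurd h hm0
  · have e2 : ∀ s : ℝ, |s| ^ 1 * Real.exp (-a * s ^ 2) * (Real.sin (s * T) / s)
      = (fun s => |s| ^ 1 * Real.exp (-a * s ^ 2) * (Real.sin (s * T) / s)) |s| := by
      intro s
      rcases abs_cases s with ⟨h, _⟩ | ⟨h, _⟩ <;> simp [h]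
    rw [integral_congr_ae (Filter.Eventually.of_forall e2)]
    rw [integral_comp_abs (f := fun s => |s| ^ 1 * Real.exp (-a * s ^ 2) * (Real.sin (s * T) / s))]
    have e3 : ∀ s ∈ Ioi (0:ℝ), |s| ^ 1 * Real.exp (-a * s ^ 2) * (Real.sin (s * T) / s)
      = Real.exp (-a * s ^ 2) * Real.sin (s * T) := by
      intro s hs
      have : (0:ℝ) < s := hs
      rw [abs_of_pos this]; field_simp
    rw [setIntegral_congr_fun measurableSet_Ioi e3]
    refine mul_nonneg (by norm_num) (bp_lc (C := 1) (by fun_prop) (fun _ => by positivity) ?_ ?_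
      (by fun_prop) (fun _ => Real.abs_sin_le_one _) ?_)
    · intro s hs t ht hst
      have : (0:ℝ) < s := hs
      simp only
      apply Real.exp_le_exp.2
      nlinarith [mul_self_le_mul_self this.le hst]
    · exact (integrable_exp_neg_mul_sq ha).integrableOn
    · intro S hS
      rw [← intervalIntegral.integral_of_le hS]
      rcases hT.eq_or_lt with rfl | hT
      · simp
      · rw [intervalIntegral.integral_comp_mul_right _ hT.ne']
        simp only [zero_mul, integral_sin, Real.cos_zero, smul_eq_mul]
        have := Real.cos_le_one (S * T)
        have : 0 ≤ 1 - Real.cos (S * T) := by linarith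
        positivity
  · have e2 : ∀ s : ℝ, |s| ^ 2 * Real.exp (-a * s ^ 2) * (Real.sin (s * T) / s)
      = Real.sin (s * T) * (s * Real.exp (-a * s ^ 2)) := by
      intro s
      rw [sq_abs]
      by_cases hs : s = 0
      · simp [hs]
      · field_simp
    simp_rw [e2]
    have hbd : ∀ {f : ℝ → ℝ} (g : ℝ → ℝ), Integrable f → (∀ s, |g s| ≤ 1) → Continuous g →
        Integrable (g * f) := by
      intro f g hf hg hgc
      exact hf.bdd_mul (c := 1) hgc.aestronglyMeasurable (Filter.Eventually.of_forall hg)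
    have key := integral_mul_deriv_eq_deriv_mul_of_integrable
      (u := fun s : ℝ => Real.sin (s * T)) (v := fun s => -(2 * a)⁻¹ * Real.exp (-a * s ^ 2))
      (u' := fun s => Real.cos (s * T) * T) (v' := fun s => s * Real.exp (-a * s ^ 2))
      (fun s _ => by
        simpa using (hasDerivAt_mul_const (x := s) T).sin)
      (fun s _ => by
        have h1 : HasDerivAt (fun s : ℝ => -a * s ^ 2) (-a * (2 * s)) s := by
          simpa using (hasDerivAt_pow 2 s).const_mul (-a)
        convert (h1.exp.const_mul (-(2 * a)⁻¹)) using 1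
        field_simp)
      (hbd _ (by simpa using integrable_mul_exp_neg_mul_sq ha) (fun _ => Real.abs_sin_le_one _)
        (by fun_prop))
      (by
        have := (hbd (fun s => Real.cos (s * T)) ((integrable_exp_neg_mul_sq ha).const_mul (T * -(2 * a)⁻¹))
          (fun _ => Real.abs_cos_le_one _) (by fun_prop))
        refine this.congr (Filter.Eventually.of_forall fun s => ?_)
        simp only [Pi.mul_apply]; ring)
      (hbd _ ((integrable_exp_neg_mul_sq ha).const_mul _) (fun _ => Real.abs_sin_le_one _)
        (by fun_prop))
    rw [key]
    have e3 : ∀ s : ℝ, Real.cos (s * T) * T * (-(2 * a)⁻¹ * Real.exp (-a * s ^ 2))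
      = -(T * (2 * a)⁻¹) * (Real.exp (-a * s ^ 2) * Real.cos (s * T)) := fun s => by ring
    simp_rw [e3]
    rw [integral_const_mul, bp_gauss_cos_real ha, neg_mul, neg_neg]
    positivity

lemma bp_kernel {a : ℝ} (ha : 0 < a) {m : ℕ} (hm : m = 0 ∨ m = 1 ∨ m = 2) {A : ℝ → ℝ}
    (hA : Measurable A) (hA0 : ∀ t, 0 ≤ A t)
    (hAanti : AntitoneOn A (Ioi 0)) (hAint : Integrable A) (heven : ∀ t, A (-t) = A t) :
    0 ≤ ∫ t, A t * ∫ s : ℝ, |s| ^ m * Real.exp (-a * s ^ 2) * Real.cos (s * t) := by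
  have e : ∀ t, A t * ∫ s : ℝ, |s| ^ m * Real.exp (-a * s ^ 2) * Real.cos (s * t)
     = (fun t => A t * ∫ s : ℝ, |s| ^ m * Real.exp (-a * s ^ 2) * Real.cos (s * t)) |t| := by
    intro t
    rcases abs_cases t with ⟨h, _⟩ | ⟨h, _⟩ <;> simp [h, heven]
  rw [integral_congr_ae (Filter.Eventually.of_forall e)]
  rw [integral_comp_abs
    (f := (fun t => A t * ∫ s : ℝ, |s| ^ m * Real.exp (-a * s ^ 2) * Real.cos (s * t)))]
  refine mul_nonneg (by norm_num) (bp_lc (C := ∫ s : ℝ, |s| ^ m * Real.exp (-a * s ^ 2)) hA hA0 hAanti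
    hAint.integrableOn ?_ ?_ (fun T hT => bp_kernel_prim ha hm hT))
  · apply StronglyMeasurable.measurable
    apply StronglyMeasurable.integral_prod_right' (f := fun p : ℝ × ℝ => |p.2| ^ m * Real.exp (-a * p.2 ^ 2) * Real.cos (p.2 * p.1))
    apply Continuous.stronglyMeasurable
    fun_prop
  · intro t
    rw [← Real.norm_eq_abs]
    refine norm_integral_le_of_norm_le (bp_w_int ha m) (Filter.Eventually.of_forall fun s => ?_)
    rw [norm_mul, Real.norm_of_nonneg (by positivity)]
    exact mul_le_of_le_one_right (by positivity) (Real.abs_cos_le_one _)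


lemma bp_R2 {b : ℝ} (hb : 0 < b) (A ζ σ : ℝ) :
    ∫ u : ℝ, Real.exp (-(u - ζ) ^ 2 / (4 * b)) * Real.cos (A + u * σ)
      = (4 * Real.pi * b) ^ ((1 : ℝ) / 2) * (Real.exp (-b * σ ^ 2) * Real.cos (A + ζ * σ)) := by
  rw [← integral_add_right_eq_self _ ζ]
  have hb' : 0 < (4 * b)⁻¹ := by positivity
  have e : ∀ u : ℝ, Real.exp (-(u + ζ - ζ) ^ 2 / (4 * b)) * Real.cos (A + (u + ζ) * σ)
      = Real.cos (A + ζ * σ) * (Real.exp (-(4 * b)⁻¹ * u ^ 2) * Real.cos (u * σ))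
        - Real.sin (A + ζ * σ) * (Real.exp (-(4 * b)⁻¹ * u ^ 2) * Real.sin (u * σ)) := by
    intro u
    have : A + (u + ζ) * σ = (A + ζ * σ) + u * σ := by ring
    rw [this, Real.cos_add, add_sub_cancel_right, neg_div, div_eq_inv_mul, ← neg_mul]
    ring
  have odd : ∫ u : ℝ, Real.exp (-(4 * b)⁻¹ * u ^ 2) * Real.sin (u * σ) = 0 := by
    have := integral_neg_eq_self (fun u : ℝ => Real.exp (-(4 * b)⁻¹ * u ^ 2) * Real.sin (u * σ)) volume
    simp only [neg_mul, even_two, Even.neg_pow, Real.sin_neg, mul_neg, integral_neg] at this ⊢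
    linarith
  have hbd : ∀ (g : ℝ → ℝ), (∀ s, |g s| ≤ 1) → Continuous g →
        Integrable (fun u => Real.exp (-(4 * b)⁻¹ * u ^ 2) * g u) := by
    intro g hg hgc
    exact (integrable_exp_neg_mul_sq hb').mul_bdd (c := 1) hgc.aestronglyMeasurable
      (Filter.Eventually.of_forall hg)
  simp_rw [e]
  rw [integral_sub, integral_const_mul, integral_const_mul, odd, bp_gauss_cos_real hb']
  · have e1 : Real.pi / (4 * b)⁻¹ = 4 * Real.pi * b := by field_simp
    have e2 : -σ ^ 2 / (4 * (4 * b)⁻¹) = -b * σ ^ 2 := by field_simp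
    rw [e1, e2]; ring
  · exact (hbd _ (fun _ => Real.abs_cos_le_one _) (by fun_prop)).const_mul _
  · exact (hbd _ (fun _ => Real.abs_sin_le_one _) (by fun_prop)).const_mul _

section FF
variable {V : Type*} [NormedAddCommGroup V] [InnerProductSpace ℝ V] [FiniteDimensional ℝ V]
  [MeasurableSpace V] [BorelSpace V]

lemma bp_F1 {b : ℝ} (hb : 0 < b) (x z : V) {τ : ℝ} (hτ : τ ≠ 0) (ζ : ℝ) :
    |τ|⁻¹ * ∫ ξ : V, Real.exp (-b * (‖ξ‖ ^ 2 + (-⟪x, ξ⟫ / τ) ^ 2)) *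
        Real.cos (⟪z, ξ⟫ + ζ * (-⟪x, ξ⟫ / τ))
      = (Real.pi / b) ^ ((Module.finrank ℝ V : ℝ) / 2) / (4 * Real.pi * b) ^ ((1 : ℝ) / 2) *
        ∫ t : ℝ, Real.exp (-(‖t • x - z‖ ^ 2 + (t * τ - ζ) ^ 2) / (4 * b)) := by
  have hC : 0 < (4 * Real.pi * b) ^ ((1 : ℝ) / 2) := by positivity
  have e1 : ∀ ξ : V, Real.exp (-b * (‖ξ‖ ^ 2 + (-⟪x, ξ⟫ / τ) ^ 2)) *
        Real.cos (⟪z, ξ⟫ + ζ * (-⟪x, ξ⟫ / τ)) = ((4 * Real.pi * b) ^ ((1 : ℝ) / 2))⁻¹ *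
        ∫ u : ℝ, Real.exp (-b * ‖ξ‖ ^ 2) * (Real.exp (-(u - ζ) ^ 2 / (4 * b)) *
          Real.cos (⟪z, ξ⟫ + u * (-⟪x, ξ⟫ / τ))) := by
    intro ξ
    rw [integral_const_mul, bp_R2 hb, mul_add, Real.exp_add]
    field_simp
  simp_rw [e1]
  rw [integral_const_mul, integral_integral_swap]
  · have e2 : ∀ u : ℝ, ∫ ξ : V, Real.exp (-b * ‖ξ‖ ^ 2) * (Real.exp (-(u - ζ) ^ 2 / (4 * b)) *
          Real.cos (⟪z, ξ⟫ + u * (-⟪x, ξ⟫ / τ))) =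
          (Real.pi / b) ^ ((Module.finrank ℝ V : ℝ) / 2) * 
          Real.exp (-(‖(u * τ⁻¹) • x - z‖ ^ 2 + (u - ζ) ^ 2) / (4 * b)) := by
      intro u
      have e3 : ∀ ξ : V, Real.exp (-b * ‖ξ‖ ^ 2) * (Real.exp (-(u - ζ) ^ 2 / (4 * b)) *
          Real.cos (⟪z, ξ⟫ + u * (-⟪x, ξ⟫ / τ))) = Real.exp (-(u - ζ) ^ 2 / (4 * b)) * 
          (Real.exp (-b * ‖ξ‖ ^ 2) * Real.cos ⟪z - (u * τ⁻¹) • x, ξ⟫) := by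
        intro ξ
        rw [inner_sub_left, real_inner_smul_left]
        have : ⟪z, ξ⟫ + u * (-⟪x, ξ⟫ / τ) = ⟪z, ξ⟫ - u * τ⁻¹ * ⟪x, ξ⟫ := by ring
        rw [this]; ring
      simp_rw [e3]
      rw [integral_const_mul, bp_gauss_cos hb, norm_sub_rev]
      have : -(‖(u * τ⁻¹) • x - z‖ ^ 2 + (u - ζ) ^ 2) / (4 * b) =
        -(u - ζ) ^ 2 / (4 * b) + -‖(u * τ⁻¹) • x - z‖ ^ 2 / (4 * b) := by ring
      rw [this, Real.exp_add]; ring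
    simp_rw [e2]
    rw [integral_const_mul]
    have := Measure.integral_comp_mul_right (fun u : ℝ =>
      Real.exp (-(‖(u * τ⁻¹) • x - z‖ ^ 2 + (u - ζ) ^ 2) / (4 * b))) τ
    simp only [mul_inv_cancel_right₀ hτ, abs_inv, smul_eq_mul] at this
    rw [this]
    field_simp
  · have i1 : Integrable (fun u : ℝ => Real.exp (-(u - ζ) ^ 2 / (4 * b))) := by
      have := (integrable_exp_neg_mul_sq (b := (4 * b)⁻¹) (by positivity)).comp_sub_right ζ
      refine this.congr (Filter.Eventually.of_forall fun u => ?_)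
      simp only; congr 1; ring
    have := (bp_gauss_int (V := V) hb).mul_prod i1
    refine this.mono' ?_ (Filter.Eventually.of_forall fun p => ?_)
    · apply Continuous.aestronglyMeasurable
      simp only [Function.uncurry_def]
      fun_prop
    · simp only [Function.uncurry_def]
      rw [← mul_assoc, norm_mul, Real.norm_of_nonneg (by positivity)]
      exact mul_le_of_le_one_right (by positivity) (Real.abs_cos_le_one _)

lemma bp_inv_sub {c : ℝ} (hc : c ≠ 0) (F : ℝ → ℝ → ℝ≥0∞) :
    ∫⁻ τ, ENNReal.ofReal |τ|⁻¹ * F τ (-c / τ) = ∫⁻ s, ENNReal.ofReal |s|⁻¹ * F (-c / s) s := by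
  have hz : ∀ G : ℝ → ℝ≥0∞, ∫⁻ s, G s = ∫⁻ s in {0}ᶜ, G s := by
    intro G
    rw [restrict_compl_singleton]
  rw [hz, hz (fun s => ENNReal.ofReal |s|⁻¹ * F (-c / s) s)]
  have im : (fun s : ℝ => -c / s) '' {0}ᶜ = {0}ᶜ := by
    ext t
    constructor
    · rintro ⟨s, hs, rfl⟩
      simp only [mem_compl_iff, mem_singleton_iff] at hs ⊢
      simp [hs, hc]
    · intro ht
      simp only [mem_compl_iff, mem_singleton_iff] at ht
      refine ⟨-c / t, by simp [ht, hc], ?_⟩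
      field_simp
  conv_lhs => rw [← im]
  rw [lintegral_image_eq_lintegral_abs_deriv_mul (f' := fun s => c / s ^ 2)
    (measurableSet_singleton 0).compl]
  · apply setLIntegral_congr_fun (measurableSet_singleton 0).compl
    intro s hs
    simp only [mem_compl_iff, mem_singleton_iff] at hs
    simp only
    rw [← mul_assoc, ← ENNReal.ofReal_mul (abs_nonneg _)]
    have e1 : |c / s ^ 2| * |-c / s|⁻¹ = |s|⁻¹ := by
      rw [abs_div, abs_div, abs_neg, abs_pow]
      have : |c| ≠ 0 := by simpa using hc
      have : |s| ≠ 0 := by simpa using hs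
      field_simp
    have e2 : -c / (-c / s) = s := by field_simp
    rw [e1, e2]
  · intro s hs
    simp only [mem_compl_iff, mem_singleton_iff] at hs
    apply HasDerivAt.hasDerivWithinAt
    have hh := (hasDerivAt_inv hs).const_mul (-c)
    have e : -c * -(s ^ 2)⁻¹ = c / s ^ 2 := by ring
    rw [e] at hh
    exact hh
  · intro s hs t ht hst
    simp only [mem_compl_iff, mem_singleton_iff] at hs ht hst
    field_simp at hst
    exact (neg_injective hst).symm

lemma bp_lint_smul (G : V → ℝ≥0∞) (hG : Measurable G) {s : ℝ} (hs : s ≠ 0) :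
    ∫⁻ v, G (s • v) = ENNReal.ofReal (|s| ^ Module.finrank ℝ V)⁻¹ * ∫⁻ v, G v := by
  rw [← lintegral_map (μ := volume) (f := G) hG (measurable_const_smul s),
    Measure.map_addHaar_smul _ hs, lintegral_smul_measure, abs_inv, abs_pow, smul_eq_mul]

lemma bp_inner_ne (hd : 1 ≤ Module.finrank ℝ V) :
    ∀ᵐ x : V, ∀ᵐ ξ : V, ⟪x, ξ⟫ ≠ 0 := by
  have : Nontrivial V := Module.nontrivial_of_finrank_pos (R := ℝ) hd
  have h0 : ∀ᵐ x : V, x ≠ 0 := by simp [ae_iff]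
  filter_upwards [h0] with x hx
  have := Measure.addHaar_submodule (volume : Measure V) (LinearMap.ker (innerₛₗ ℝ x)) (by
    intro h
    rw [LinearMap.ker_eq_top] at h
    have := congrArg (fun f => f x) h
    simp [hx] at this)
  rw [ae_iff]
  convert this using 2
  ext ξ
  simp

lemma bp_swap (hd : 1 ≤ Module.finrank ℝ V) (f B : V × ℝ → ℝ≥0∞) (hf : Measurable f)
    (hB : Measurable B) :
    ∫⁻ x : V × ℝ, f x * (ENNReal.ofReal |x.2|⁻¹ * ∫⁻ ξ : V, B (ξ, -⟪x.1, ξ⟫ / x.2))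
      = ∫⁻ v : V, (∫⁻ x : V, f (x, -⟪x, v⟫)) *
        ∫⁻ s : ℝ, ENNReal.ofReal (|s| ^ (Module.finrank ℝ V - 1)) * B (s • v, s) := by
  calc _ = ∫⁻ x : V, ∫⁻ τ : ℝ, f (x, τ) * (ENNReal.ofReal |τ|⁻¹ * ∫⁻ ξ : V, B (ξ, -⟪x, ξ⟫ / τ)) := by
        rw [Measure.volume_eq_prod, lintegral_prod]
        apply Measurable.aemeasurable
        apply hf.mul (Measurable.mul (by fun_prop) _)
        apply Measurable.lintegral_prod_right' (f := fun p : (V × ℝ) × V => B (p.2, -⟪p.1.1, p.2⟫ / p.1.2))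
        fun_prop
    _ = ∫⁻ x : V, ∫⁻ τ : ℝ, ∫⁻ ξ : V, ENNReal.ofReal |τ|⁻¹ * (f (x, τ) * B (ξ, -⟪x, ξ⟫ / τ)) := by
        congr 1; ext x; congr 1; ext τ
        rw [lintegral_const_mul _ (by fun_prop), lintegral_const_mul _ (by fun_prop)]
        ring
    _ = ∫⁻ x : V, ∫⁻ ξ : V, ∫⁻ τ : ℝ, ENNReal.ofReal |τ|⁻¹ * (f (x, τ) * B (ξ, -⟪x, ξ⟫ / τ)) := by
        congr 1; ext x
        rw [lintegral_lintegral_swap]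
        apply Measurable.aemeasurable
        simp only [Function.uncurry_def]
        fun_prop
    _ = ∫⁻ x : V, ∫⁻ ξ : V, ∫⁻ s : ℝ, ENNReal.ofReal |s|⁻¹ * (f (x, -⟪x, ξ⟫ / s) * B (ξ, s)) := by
        apply lintegral_congr_ae
        filter_upwards [bp_inner_ne hd] with x hx
        apply lintegral_congr_ae
        filter_upwards [hx] with ξ hξ
        exact bp_inv_sub hξ (fun τ s => f (x, τ) * B (ξ, s))
    _ = ∫⁻ x : V, ∫⁻ s : ℝ, ∫⁻ ξ : V, ENNReal.ofReal |s|⁻¹ * (f (x, -⟪x, ξ⟫ / s) * B (ξ, s)) := by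
        congr 1; ext x
        rw [lintegral_lintegral_swap]
        apply Measurable.aemeasurable
        simp only [Function.uncurry_def]
        fun_prop
    _ = ∫⁻ x : V, ∫⁻ s : ℝ, ∫⁻ v : V, ENNReal.ofReal (|s| ^ (Module.finrank ℝ V - 1)) *
          (f (x, -⟪x, v⟫) * B (s • v, s)) := by
        congr 1; ext x
        apply lintegral_congr_ae
        have h0 : ∀ᵐ s : ℝ, s ≠ 0 := by simp [ae_iff]
        filter_upwards [h0] with s hs
        have := bp_lint_smul (V := V) (fun ξ => f (x, -⟪x, ξ⟫ / s) * B (ξ, s)) (by fun_prop) hs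
        rw [lintegral_const_mul _ (by fun_prop), lintegral_const_mul _ (by fun_prop)]
        have e : ∀ v : V, -⟪x, s • v⟫ / s = -⟪x, v⟫ := by
          intro v; rw [real_inner_smul_right]; field_simp
        simp only [e] at this
        rw [this, ← mul_assoc, ← ENNReal.ofReal_mul (by positivity)]
        congr 2
        have hs' : |s| ≠ 0 := by simpa using hs
        obtain ⟨k, hk⟩ : ∃ k, Module.finrank ℝ V = k + 1 := ⟨_, (Nat.sub_add_cancel hd).symm⟩
        rw [hk, Nat.add_sub_cancel, pow_succ]
        field_simp
    _ = ∫⁻ x : V, ∫⁻ v : V, ∫⁻ s : ℝ, ENNReal.ofReal (|s| ^ (Module.finrank ℝ V - 1)) *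
          (f (x, -⟪x, v⟫) * B (s • v, s)) := by
        congr 1; ext x
        rw [lintegral_lintegral_swap]
        apply Measurable.aemeasurable
        simp only [Function.uncurry_def]
        fun_prop
    _ = ∫⁻ x : V, ∫⁻ v : V, f (x, -⟪x, v⟫) *
          ∫⁻ s : ℝ, ENNReal.ofReal (|s| ^ (Module.finrank ℝ V - 1)) * B (s • v, s) := by
        congr 1; ext x; congr 1; ext v
        rw [← lintegral_const_mul _ (by fun_prop)]
        congr 1; ext s
        ring
    _ = _ := by
        have hm : Measurable fun v : V => 
            ∫⁻ s : ℝ, ENNReal.ofReal (|s| ^ (Module.finrank ℝ V - 1)) * B (s • v, s) := by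
          apply Measurable.lintegral_prod_right' (f := fun p : V × ℝ =>
            ENNReal.ofReal (|p.2| ^ (Module.finrank ℝ V - 1)) * B (p.2 • p.1, p.2))
          fun_prop
        rw [lintegral_lintegral_swap]
        · congr 1; ext v
          rw [lintegral_mul_const _ (by fun_prop)]
        · apply Measurable.aemeasurable
          simp only [Function.uncurry_def]
          fun_prop
end FF



section DD
variable {V : Type*} [NormedAddCommGroup V] [InnerProductSpace ℝ V] [FiniteDimensional ℝ V]
  [MeasurableSpace V] [BorelSpace V]

lemma bp_inv_norm (hd : 1 ≤ Module.finrank ℝ V) {L : Set (V × ℝ)} (hL : Bornology.IsBounded L)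
    (hLm : MeasurableSet L) :
    ∫⁻ x in L, ENNReal.ofReal ‖x‖⁻¹ ≠ ∞ := by
  obtain ⟨R, hR0, hR⟩ := hL.exists_pos_norm_le
  have hE : Module.finrank ℝ (V × ℝ) = Module.finrank ℝ V + 1 := by simp
  have h1 : Integrable (fun x : V × ℝ => (Iic R).indicator (fun r => r⁻¹) ‖x‖) := by
    rw [Measure.volume_eq_prod]
    rw [integrable_fun_norm_addHaar (E := V × ℝ) ((volume : Measure V).prod (volume : Measure ℝ))
      (f := (Iic R).indicator (fun r => r⁻¹))]
    rw [hE, Nat.add_sub_cancel]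
    have h2 : IntegrableOn ((Ioc 0 R).indicator (fun r : ℝ => r ^ (Module.finrank ℝ V - 1))) (Ioi 0) := by
      rw [integrableOn_indicator_iff measurableSet_Ioc]
      refine IntegrableOn.mono_set (t := Icc 0 R) ?_ (inter_subset_left.trans Ioc_subset_Icc_self)
      exact (by fun_prop : Continuous fun r : ℝ => r ^ (Module.finrank ℝ V - 1)).integrableOn_Icc
    refine h2.congr_fun ?_ measurableSet_Ioi
    intro r hr
    have hr' : (0:ℝ) < r := hr
    obtain ⟨k, hk⟩ : ∃ k, Module.finrank ℝ V = k + 1 := ⟨_, (Nat.sub_add_cancel hd).symm⟩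
    simp only [indicator, mem_Ioc, mem_Iic, hr', true_and, smul_eq_mul, hk, Nat.add_sub_cancel]
    split_ifs
    · rw [pow_succ]; field_simp
    · simp
  have h3 := h1.integrableOn (s := L)
  have h4 := (hasFiniteIntegral_iff_ofReal (Filter.Eventually.of_forall fun x => by
    simp only [indicator, Pi.zero_apply]; split_ifs <;> positivity)).1 h3.2
  refine (lt_of_le_of_lt (setLIntegral_mono' hLm fun x hx => ?_) h4).ne
  rw [indicator_of_mem (show ‖x‖ ∈ Iic R from hR x hx)]

lemma bp_unimodal (hPL : BPPL (volume : Measure V)) {K : Set (V × ℝ)} (hK : MeasurableSet K)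
    (hconv : Convex ℝ K) (hsymm : ∀ z ∈ K, -z ∈ K) {s t : ℝ} (hs : 0 ≤ s) (hst : s ≤ t) :
    volume {z : V | (z, t) ∈ K} ≤ volume {z : V | (z, s) ∈ K} := by
  rcases hst.eq_or_lt with rfl | hst
  · exact le_rfl
  have ht : 0 < t := lt_of_le_of_lt hs hst
  have hm : ∀ t : ℝ, MeasurableSet {z : V | (z, t) ∈ K} := fun t =>
    (by fun_prop : Measurable fun z : V => (z, t)) hK
  have ev : volume {z : V | (z, -t) ∈ K} = volume {z : V | (z, t) ∈ K} := by
    rw [← Measure.measure_neg volume {z : V | (z, t) ∈ K}]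
    congr 1
    ext z
    simp only [mem_ofPred_eq, mem_neg]
    constructor
    · intro h; simpa using hsymm _ h
    · intro h; simpa using hsymm _ h
  have a0 : 0 < (t + s) / (2 * t) := by positivity
  have b0 : 0 < (t - s) / (2 * t) := div_pos (by linarith) (by positivity)
  have ab : (t + s) / (2 * t) + (t - s) / (2 * t) = 1 := by field_simp; ring
  have key := hPL _ _ a0 b0 ab ({z : V | (z, t) ∈ K}.indicator 1)
    ({z : V | (z, -t) ∈ K}.indicator 1) ({z : V | (z, s) ∈ K}.indicator 1)
    (measurable_one.indicator (hm _)) (measurable_one.indicator (hm _))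
    (measurable_one.indicator (hm _)) (by
      intro x y
      by_cases hx : (x, t) ∈ K
      · by_cases hy : (y, -t) ∈ K
        · have := hconv hx hy a0.le b0.le ab
          have e : ((t + s) / (2 * t)) • ((x, t) : V × ℝ) + ((t - s) / (2 * t)) • ((y, -t) : V × ℝ)
            = (((t + s) / (2 * t)) • x + ((t - s) / (2 * t)) • y, s) := by
            ext
            · simp
            · simp; field_simp; ring
          rw [e] at this
          simp [hx, hy, this]
        · simp [hy, ENNReal.zero_rpow_of_pos b0]
      · simp [hx, ENNReal.zero_rpow_of_pos a0])
  rw [lintegral_indicator_one (hm _), lintegral_indicator_one (hm _), lintegral_indicator_one (hm _),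
    ev, ← ENNReal.rpow_add_of_nonneg _ _ a0.le b0.le, ab, ENNReal.rpow_one] at key
  exact key

lemma bp_qpos (hPL : BPPL (volume : Measure V)) {K : Set (V × ℝ)} (hK : IsCompact K)
    (hconv : Convex ℝ K) (hsymm : ∀ z ∈ K, -z ∈ K) {m : ℕ} (hm : m = 0 ∨ m = 1 ∨ m = 2)
    {a : ℝ} (ha : 0 < a) (v : V) :
    0 ≤ ∫ s : ℝ, |s| ^ m * Real.exp (-a * s ^ 2) *
      ∫ z in K, Real.cos (⟪z.1, s • v⟫ + z.2 * s) := by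
  set S : V × ℝ → V × ℝ := fun z => (z.1, z.2 + ⟪z.1, v⟫) with hS
  have hSc : Continuous S := by fun_prop
  have hSi : Function.Injective S := by
    rintro ⟨x, y⟩ ⟨x', y'⟩ h
    simp only [hS, Prod.mk.injEq] at h
    obtain ⟨rfl, h⟩ := h
    simpa using h
  have hSm : MeasurePreserving S (volume : Measure (V × ℝ)) volume := by
    rw [Measure.volume_eq_prod]
    refine MeasurePreserving.skew_product (g := fun x y => y + ⟪x, v⟫)
      (MeasurePreserving.id (volume : Measure V)) (by fun_prop) ?_
    exact Filter.Eventually.of_forall fun x => map_add_right_eq_self volume _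
  have hSe : MeasurableEmbedding S := hSc.measurableEmbedding hSi
  set K' := S '' K with hK'
  have hKc : IsCompact K' := hK.image hSc
  have hpre : K = S ⁻¹' K' := (preimage_image_eq K hSi).symm
  have hconv' : Convex ℝ K' := by
    apply hconv.is_linear_image
    constructor
    · intro x y; ext <;> simp [hS, inner_add_left]; ring
    · intro c x; ext <;> simp [hS, inner_smul_left, mul_add]
  have hsymm' : ∀ z ∈ K', -z ∈ K' := by
    rintro _ ⟨z, hz, rfl⟩
    refine ⟨-z, hsymm z hz, ?_⟩
    ext <;> simp [hS, add_comm]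
  set φ : ℝ → ℝ := fun t => ∫ s : ℝ, |s| ^ m * Real.exp (-a * s ^ 2) * Real.cos (s * t) with hφ
  have hKfin : volume K ≠ ∞ := hK.measure_lt_top.ne
  have hKfin' : volume K' ≠ ∞ := hKc.measure_lt_top.ne
  have : IsFiniteMeasure ((volume : Measure (V × ℝ)).restrict K) := ⟨by simpa using hKfin.lt_top⟩
  have : IsFiniteMeasure ((volume : Measure (V × ℝ)).restrict K') := ⟨by simpa using hKfin'.lt_top⟩
  have e1 : ∫ s : ℝ, |s| ^ m * Real.exp (-a * s ^ 2) *
      ∫ z in K, Real.cos (⟪z.1, s • v⟫ + z.2 * s) = ∫ z in K, φ ((S z).2) := by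
    simp_rw [← integral_const_mul]
    rw [integral_integral_swap]
    · congr 1; ext z
      simp only [hφ]
      congr 1; ext s
      congr 2
      simp only [hS, inner_smul_right]; ring
    · have := (bp_w_int ha m).mul_prod (g := fun _ : V × ℝ => (1:ℝ)) (ν := volume.restrict K)
        (integrable_const 1)
      refine this.mono' (Continuous.aestronglyMeasurable ?_) (Filter.Eventually.of_forall fun p => ?_)
      · simp only [Function.uncurry_def]; fun_prop
      · simp only [Function.uncurry_def]
        rw [norm_mul, mul_one, Real.norm_of_nonneg (by positivity)]
        exact mul_le_of_le_one_right (by positivity) (Real.abs_cos_le_one _)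
  have hφm : Measurable φ := by
    apply StronglyMeasurable.measurable
    apply StronglyMeasurable.integral_prod_right' (f := fun p : ℝ × ℝ => |p.2| ^ m * Real.exp (-a * p.2 ^ 2) * Real.cos (p.2 * p.1))
    apply Continuous.stronglyMeasurable
    fun_prop
  have hφb : ∀ t, |φ t| ≤ ∫ s : ℝ, |s| ^ m * Real.exp (-a * s ^ 2) := by
    intro t
    rw [← Real.norm_eq_abs]
    refine norm_integral_le_of_norm_le (bp_w_int ha m) (Filter.Eventually.of_forall fun s => ?_)
    rw [norm_mul, Real.norm_of_nonneg (by positivity)]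
    exact mul_le_of_le_one_right (by positivity) (Real.abs_cos_le_one _)
  have hsl : ∀ t : ℝ, MeasurableSet {z : V | (z, t) ∈ K'} := fun t =>
    (by fun_prop : Measurable fun z : V => (z, t)) hKc.measurableSet
  have hslfin : ∀ t : ℝ, volume {z : V | (z, t) ∈ K'} ≠ ∞ := by
    intro t
    refine (lt_of_le_of_lt (measure_mono ?_) (hKc.image continuous_fst).measure_lt_top).ne
    intro z hz
    exact ⟨(z, t), hz, rfl⟩
  have e2 : ∫ z in K, φ ((S z).2) = ∫ t, (volume {z : V | (z, t) ∈ K'}).toReal * φ t := by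
    conv_lhs => rw [hpre]
    rw [hSm.setIntegral_preimage_emb hSe (fun p => φ p.2), ← integral_indicator hKc.measurableSet,
      Measure.volume_eq_prod, integral_prod_symm]
    · congr 1; ext t
      have : (fun z : V => K'.indicator (fun p => φ p.2) (z, t))
        = {z : V | (z, t) ∈ K'}.indicator (fun _ => φ t) := by
        ext z; simp [indicator]
      rw [this, integral_indicator_const _ (hsl t), measureReal_def, smul_eq_mul]
    · rw [integrable_indicator_iff hKc.measurableSet]
      exact Measure.integrableOn_of_bounded hKfin' (hφm.comp measurable_snd).aestronglyMeasurable
        (Filter.Eventually.of_forall fun p => hφb p.2)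
  rw [e1, e2]
  have hmeas : Measurable fun t => volume {z : V | (z, t) ∈ K'} :=
    measurable_measure_prodMk_right hKc.measurableSet
  refine bp_kernel ha hm hmeas.ennreal_toReal (fun _ => ENNReal.toReal_nonneg) ?_ ?_ ?_
  · intro s hs t ht hst
    exact ENNReal.toReal_mono (hslfin s) (bp_unimodal hPL hKc.measurableSet hconv' hsymm' (le_of_lt hs) hst)
  · apply integrable_toReal_of_lintegral_ne_top hmeas.aemeasurable
    have := Measure.prod_apply_symm (μ := (volume : Measure V)) (ν := (volume : Measure ℝ)) hKc.measurableSet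
    rw [← Measure.volume_eq_prod] at this
    exact this ▸ hKfin'
  · intro t
    congr 1
    rw [← Measure.measure_neg volume {z : V | (z, t) ∈ K'}]
    congr 1
    ext z
    simp only [mem_ofPred_eq, mem_neg]
    constructor
    · intro h; simpa using hsymm' _ h
    · intro h; simpa using hsymm' _ h
end DD



section EE
variable {V : Type*} [NormedAddCommGroup V] [InnerProductSpace ℝ V] [FiniteDimensional ℝ V]
  [MeasurableSpace V] [BorelSpace V]

/-- Gaussian-damped cosine transform of a set. -/
noncomputable def bpB (K : Set (V × ℝ)) (b : ℝ) (p : V × ℝ) : ℝ :=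
  Real.exp (-b * (‖p.1‖ ^ 2 + p.2 ^ 2)) * ∫ z in K, Real.cos (⟪z.1, p.1⟫ + z.2 * p.2)

/-- Gaussian along a ray. -/
noncomputable def bpG (b t : ℝ) (x z : V × ℝ) : ℝ :=
  Real.exp (-(‖t • x.1 - z.1‖ ^ 2 + (t * x.2 - z.2) ^ 2) / (4 * b))

lemma bpB_cont {K : Set (V × ℝ)} (hK : IsCompact K) (b : ℝ) : Measurable (bpB K b) := by
  have : IsFiniteMeasure ((volume : Measure (V × ℝ)).restrict K) := ⟨by simpa using hK.measure_lt_top⟩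
  apply Measurable.mul (by fun_prop)
  apply StronglyMeasurable.measurable
  apply StronglyMeasurable.integral_prod_right' (f := fun p : (V × ℝ) × (V × ℝ) =>
    Real.cos (⟪p.2.1, p.1.1⟫ + p.2.2 * p.1.2))
  apply Continuous.stronglyMeasurable
  fun_prop

lemma bpB_abs {K : Set (V × ℝ)} (hK : IsCompact K) (b : ℝ) (p : V × ℝ) :
    |bpB K b p| ≤ Real.exp (-b * (‖p.1‖ ^ 2 + p.2 ^ 2)) * (volume K).toReal := by
  have : IsFiniteMeasure ((volume : Measure (V × ℝ)).restrict K) := ⟨by simpa using hK.measure_lt_top⟩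
  rw [bpB, abs_mul, abs_of_pos (Real.exp_pos _)]
  gcongr
  have := norm_setIntegral_le_of_norm_le_const (μ := volume) (s := K) (C := 1)
    (f := fun z : V × ℝ => Real.cos (⟪z.1, p.1⟫ + z.2 * p.2)) hK.measure_lt_top
    (fun z _ => Real.abs_cos_le_one _)
  simpa [measureReal_def] using this

lemma bp_ray_int {b : ℝ} (hb : 0 < b) (x z : V × ℝ) (hx : x.2 ≠ 0) :
    Integrable fun t => bpG b t x z := by
  have i1 : Integrable (fun u : ℝ => Real.exp (-(u * x.2 - z.2) ^ 2 / (4 * b))) := by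
    have := (integrable_exp_neg_mul_sq (b := (4 * b)⁻¹) (by positivity)).comp_sub_right z.2
    have := this.comp_mul_right' hx
    refine this.congr (Filter.Eventually.of_forall fun u => ?_)
    simp only; congr 1; ring
  refine i1.mono' (Continuous.aestronglyMeasurable (by unfold bpG; fun_prop)) (Filter.Eventually.of_forall fun t => ?_)
  unfold bpG
  rw [Real.norm_of_nonneg (by positivity)]
  gcongr
  nlinarith [sq_nonneg ‖t • x.1 - z.1‖]

/-- constant -/
noncomputable def bpC (V : Type*) [NormedAddCommGroup V] [InnerProductSpace ℝ V] (b : ℝ) : ℝ :=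
  (Real.pi / b) ^ ((Module.finrank ℝ V : ℝ) / 2) / (4 * Real.pi * b) ^ ((1 : ℝ) / 2)

lemma bp_exp_le {b : ℝ} (hb : 0 < b) (A B : ℝ) :
    Real.exp (-b * (A + B ^ 2)) ≤ Real.exp (-b * A) := by
  apply Real.exp_le_exp.2
  nlinarith [mul_nonneg hb.le (sq_nonneg B)]

lemma bp_pt {K : Set (V × ℝ)} (hK : IsCompact K) {b : ℝ} (hb : 0 < b) (x : V × ℝ) (hx : x.2 ≠ 0) :
    ENNReal.ofReal (bpC V b) * (∫⁻ z in K, ∫⁻ t : ℝ, ENNReal.ofReal (bpG b t x z))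
      + ENNReal.ofReal |x.2|⁻¹ * ∫⁻ ξ : V, ENNReal.ofReal (-bpB K b (ξ, -⟪x.1, ξ⟫ / x.2))
      = ENNReal.ofReal |x.2|⁻¹ * ∫⁻ ξ : V, ENNReal.ofReal (bpB K b (ξ, -⟪x.1, ξ⟫ / x.2)) := by
  have : IsFiniteMeasure ((volume : Measure (V × ℝ)).restrict K) := ⟨by simpa using hK.measure_lt_top⟩
  have hC : 0 < bpC V b := by unfold bpC; positivity
  have hBi : Integrable fun ξ : V => bpB K b (ξ, -⟪x.1, ξ⟫ / x.2) := by
    refine ((bp_gauss_int (V := V) hb).mul_const (volume K).toReal).mono'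
      ((bpB_cont hK b).comp (by fun_prop)).aestronglyMeasurable (Filter.Eventually.of_forall fun ξ => ?_)
    refine (bpB_abs hK b _).trans ?_
    simp only
    exact mul_le_mul_of_nonneg_right (bp_exp_le hb _ _) ENNReal.toReal_nonneg
  have hJ : Integrable (fun p : V × (V × ℝ) => Real.exp (-b * (‖p.1‖ ^ 2 + (-⟪x.1, p.1⟫ / x.2) ^ 2)) *
        Real.cos (⟪p.2.1, p.1⟫ + p.2.2 * (-⟪x.1, p.1⟫ / x.2)))
        ((volume : Measure V).prod (volume.restrict K)) := by
    have := (bp_gauss_int (V := V) hb).mul_prod (g := fun _ : V × ℝ => (1:ℝ)) (ν := volume.restrict K)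
        (integrable_const 1)
    refine this.mono' (Continuous.aestronglyMeasurable (by fun_prop)) (Filter.Eventually.of_forall fun p => ?_)
    rw [norm_mul, mul_one, Real.norm_of_nonneg (by positivity)]
    refine (mul_le_of_le_one_right (by positivity) (Real.abs_cos_le_one _)).trans ?_
    exact bp_exp_le hb _ _
  have hF : ∀ z : V × ℝ, |x.2|⁻¹ * ∫ ξ : V, Real.exp (-b * (‖ξ‖ ^ 2 + (-⟪x.1, ξ⟫ / x.2) ^ 2)) *
        Real.cos (⟪z.1, ξ⟫ + z.2 * (-⟪x.1, ξ⟫ / x.2)) = bpC V b * ∫ t : ℝ, bpG b t x z :=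
    fun z => bp_F1 hb x.1 z.1 hx z.2
  have hzi : Integrable (fun z => ∫ t : ℝ, bpG b t x z) (volume.restrict K) := by
    have h1 := (hJ.integral_prod_right).const_mul |x.2|⁻¹
    have h2 := (h1.congr (Filter.Eventually.of_forall hF)).const_mul (bpC V b)⁻¹
    refine h2.congr (Filter.Eventually.of_forall fun z => ?_)
    simp only; field_simp
  have hre : |x.2|⁻¹ * ∫ ξ : V, bpB K b (ξ, -⟪x.1, ξ⟫ / x.2) =
      bpC V b * ∫ z in K, ∫ t : ℝ, bpG b t x z := by
    unfold bpB
    simp_rw [← integral_const_mul]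
    rw [integral_integral_swap]
    · simp_rw [← integral_const_mul] at hF
      simp_rw [integral_const_mul |x.2|⁻¹]
      rw [← integral_const_mul]
      simp_rw [← integral_const_mul]
      exact integral_congr_ae (Filter.Eventually.of_forall hF)
    · exact hJ.const_mul _
  have hT : ∫⁻ z in K, ∫⁻ t : ℝ, ENNReal.ofReal (bpG b t x z) =
      ENNReal.ofReal (∫ z in K, ∫ t : ℝ, bpG b t x z) := by
    rw [ofReal_integral_eq_lintegral_ofReal hzi (Filter.Eventually.of_forall fun z =>
      integral_nonneg fun t => (Real.exp_pos _).le)]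
    congr 1; ext z
    rw [ofReal_integral_eq_lintegral_ofReal (bp_ray_int hb x z hx) (Filter.Eventually.of_forall fun t => (Real.exp_pos _).le)]
  have hP : ∫⁻ ξ : V, ENNReal.ofReal (bpB K b (ξ, -⟪x.1, ξ⟫ / x.2)) ≠ ∞ := by
    have := hBi.lintegral_lt_top
    exact this.ne
  have hN : ∫⁻ ξ : V, ENNReal.ofReal (-bpB K b (ξ, -⟪x.1, ξ⟫ / x.2)) ≠ ∞ := by
    have := hBi.neg.lintegral_lt_top
    exact this.ne
  rw [integral_eq_lintegral_pos_part_sub_lintegral_neg_part hBi] at hre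
  rw [hT, ← ENNReal.ofReal_mul hC.le, ← hre]
  rw [← ENNReal.ofReal_toReal hN, ← ENNReal.ofReal_toReal hP, ← ENNReal.ofReal_mul (by positivity),
    ← ENNReal.ofReal_mul (by positivity), ENNReal.toReal_ofReal (by positivity),
    ENNReal.toReal_ofReal (by positivity), ← ENNReal.ofReal_add]
  · congr 1; ring
  · rw [hre]
    exact mul_nonneg hC.le (integral_nonneg fun z => integral_nonneg fun t => (Real.exp_pos _).le)
  · positivity

end EE



section FF2
variable {V : Type*} [NormedAddCommGroup V] [InnerProductSpace ℝ V] [FiniteDimensional ℝ V]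
  [MeasurableSpace V] [BorelSpace V]

lemma bp_ae_snd : ∀ᵐ x : V × ℝ, x.2 ≠ 0 := by
  have : MeasurableSet {x : V × ℝ | x.2 ≠ 0} := (measurable_snd (measurableSet_singleton (0:ℝ))).compl
  rw [Measure.volume_eq_prod, Measure.ae_prod_iff_ae_ae this]
  refine Filter.Eventually.of_forall fun x => ?_
  simp [ae_iff]

lemma bp_norm_le (x : V × ℝ) : ‖x‖ ^ 2 ≤ ‖x.1‖ ^ 2 + x.2 ^ 2 := by
  rcases max_choice ‖x.1‖ ‖x.2‖ with h | h
  · rw [Prod.norm_def, h]; nlinarith [sq_nonneg x.2]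
  · rw [Prod.norm_def, h, Real.norm_eq_abs, sq_abs]; nlinarith [sq_nonneg ‖x.1‖]

lemma bp_fin (hd : 1 ≤ Module.finrank ℝ V) {L : Set (V × ℝ)} (hL : IsCompact L) {b : ℝ} (hb : 0 < b) :
    ∫⁻ x in L, (ENNReal.ofReal |x.2|⁻¹ * ∫⁻ ξ : V, ENNReal.ofReal
      (Real.exp (-b * (‖ξ‖ ^ 2 + (-⟪x.1, ξ⟫ / x.2) ^ 2)))) ≠ ∞ := by
  have hC : 0 < bpC V b := by unfold bpC; positivity
  have key : ∀ x : V × ℝ, x.2 ≠ 0 → (ENNReal.ofReal |x.2|⁻¹ * ∫⁻ ξ : V, ENNReal.ofReal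
      (Real.exp (-b * (‖ξ‖ ^ 2 + (-⟪x.1, ξ⟫ / x.2) ^ 2)))) ≤
      ENNReal.ofReal (bpC V b * √(Real.pi * (4 * b))) * ENNReal.ofReal ‖x‖⁻¹ := by
    intro x hx
    have hx0 : 0 < ‖x‖ := norm_pos_iff.2 fun h => hx (by simp [h])
    have h1 := bp_F1 hb x.1 0 hx 0
    change _ = bpC V b * _ at h1
    simp only [inner_zero_left, zero_mul, add_zero, Real.cos_zero, mul_one, sub_zero] at h1
    have i1 : Integrable fun ξ : V => Real.exp (-b * (‖ξ‖ ^ 2 + (-⟪x.1, ξ⟫ / x.2) ^ 2)) := by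
      refine (bp_gauss_int (V := V) hb).mono' (Measurable.aestronglyMeasurable (by fun_prop))
        (Filter.Eventually.of_forall fun ξ => ?_)
      rw [Real.norm_of_nonneg (by positivity)]
      exact bp_exp_le hb _ _
    rw [← ofReal_integral_eq_lintegral_ofReal i1 (Filter.Eventually.of_forall fun _ => (Real.exp_pos _).le),
      ← ENNReal.ofReal_mul (by positivity), ← ENNReal.ofReal_mul (by positivity), h1]
    apply ENNReal.ofReal_le_ofReal
    rw [mul_assoc (bpC V b)]
    refine mul_le_mul_of_nonneg_left ?_ hC.le
    have h2 := integral_gaussian (‖x‖ ^ 2 / (4 * b))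
    have e : Real.pi / (‖x‖ ^ 2 / (4 * b)) = (Real.pi * (4 * b)) / ‖x‖ ^ 2 := by field_simp
    rw [e, Real.sqrt_div (by positivity), Real.sqrt_sq hx0.le] at h2
    rw [← div_eq_mul_inv, ← h2]
    apply integral_mono_of_nonneg (Filter.Eventually.of_forall fun _ => (Real.exp_pos _).le)
      (integrable_exp_neg_mul_sq (by positivity))
    refine Filter.Eventually.of_forall fun t => ?_
    simp only
    apply Real.exp_le_exp.2
    rw [norm_smul, mul_pow, mul_pow, Real.norm_eq_abs, sq_abs]
    rw [← mul_add, neg_mul, neg_div, neg_le_neg_iff, div_mul_eq_mul_div]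
    have := mul_le_mul_of_nonneg_left (bp_norm_le x) (sq_nonneg t)
    exact div_le_div_of_nonneg_right (by linarith) (by positivity)
  have h3 : ∫⁻ x in L, ENNReal.ofReal (bpC V b * √(Real.pi * (4 * b))) * ENNReal.ofReal ‖x‖⁻¹ ≠ ∞ := by
    rw [lintegral_const_mul _ (by fun_prop)]
    exact ENNReal.mul_ne_top ENNReal.ofReal_ne_top (bp_inv_norm hd hL.isBounded hL.measurableSet)
  refine ((lintegral_mono_ae ?_).trans_lt h3.lt_top).ne
  exact ae_restrict_of_ae (bp_ae_snd.mono key)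

lemma bp_swap_set (hd : 1 ≤ Module.finrank ℝ V) {L : Set (V × ℝ)} (hL : MeasurableSet L)
    (B : V × ℝ → ℝ≥0∞) (hB : Measurable B) :
    ∫⁻ x in L, (ENNReal.ofReal |x.2|⁻¹ * ∫⁻ ξ : V, B (ξ, -⟪x.1, ξ⟫ / x.2))
      = ∫⁻ v : V, volume {x : V | (x, -⟪x, v⟫) ∈ L} *
        ∫⁻ s : ℝ, ENNReal.ofReal (|s| ^ (Module.finrank ℝ V - 1)) * B (s • v, s) := by
  have h := bp_swap hd (L.indicator 1) B (measurable_one.indicator hL) hB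
  have e1 : ∀ v : V, ∫⁻ x : V, L.indicator (1 : V × ℝ → ℝ≥0∞) (x, -⟪x, v⟫) =
      volume {x : V | (x, -⟪x, v⟫) ∈ L} := by
    intro v
    rw [← lintegral_indicator_one (show MeasurableSet {x : V | (x, -⟪x, v⟫) ∈ L} from
      (by fun_prop : Measurable fun x : V => (x, -⟪x, v⟫)) hL)]
    rfl
  simp_rw [e1] at h
  rw [← h, ← lintegral_indicator hL]
  congr 1; ext x
  by_cases hx : x ∈ L <;> simp [hx]

lemma bp_fixed (hd : 1 ≤ Module.finrank ℝ V) (hd3 : Module.finrank ℝ V ≤ 3)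
    (hPL : BPPL (volume : Measure V)) {K L : Set (V × ℝ)} (hK : IsCompact K)
    (hconv : Convex ℝ K) (hsymm : ∀ z ∈ K, -z ∈ K) (hL : IsCompact L)
    (hsec : ∀ v : V, volume {x : V | (x, -⟪x, v⟫) ∈ K} ≤ volume {x : V | (x, -⟪x, v⟫) ∈ L})
    {b : ℝ} (hb : 0 < b) :
    ∫⁻ x in K, ∫⁻ z in K, ∫⁻ t : ℝ, ENNReal.ofReal (bpG b t x z) ≤
    ∫⁻ x in L, ∫⁻ z in K, ∫⁻ t : ℝ, ENNReal.ofReal (bpG b t x z) := by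
  have : IsFiniteMeasure ((volume : Measure (V × ℝ)).restrict K) := ⟨by simpa using hK.measure_lt_top⟩
  have hC : 0 < bpC V b := by unfold bpC; positivity
  have hBm := bpB_cont hK b
  set N : V × ℝ → ℝ≥0∞ := fun x => ENNReal.ofReal |x.2|⁻¹ *
    ∫⁻ ξ : V, ENNReal.ofReal (-bpB K b (ξ, -⟪x.1, ξ⟫ / x.2)) with hN
  set P : V × ℝ → ℝ≥0∞ := fun x => ENNReal.ofReal |x.2|⁻¹ *
    ∫⁻ ξ : V, ENNReal.ofReal (bpB K b (ξ, -⟪x.1, ξ⟫ / x.2)) with hP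
  set T : V × ℝ → ℝ≥0∞ := fun x => ∫⁻ z in K, ∫⁻ t : ℝ, ENNReal.ofReal (bpG b t x z) with hT
  have hNm : Measurable N := by
    apply Measurable.mul (by fun_prop)
    apply Measurable.lintegral_prod_right' (f := fun p : (V × ℝ) × V => 
      ENNReal.ofReal (-bpB K b (p.2, -⟪p.1.1, p.2⟫ / p.1.2)))
    fun_prop
  have hTm : Measurable T := by
    apply Measurable.lintegral_prod_right' (f := fun p : (V × ℝ) × (V × ℝ) => 
      ∫⁻ t : ℝ, ENNReal.ofReal (bpG b t p.1 p.2))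
    apply Measurable.lintegral_prod_right' (f := fun p : ((V × ℝ) × (V × ℝ)) × ℝ => 
      ENNReal.ofReal (bpG b p.2 p.1.1 p.1.2))
    unfold bpG
    fun_prop
  set qp : V → ℝ≥0∞ := fun v => ∫⁻ s : ℝ, ENNReal.ofReal (|s| ^ (Module.finrank ℝ V - 1)) *
    ENNReal.ofReal (bpB K b (s • v, s)) with hqp
  set qm : V → ℝ≥0∞ := fun v => ∫⁻ s : ℝ, ENNReal.ofReal (|s| ^ (Module.finrank ℝ V - 1)) *
    ENNReal.ofReal (-bpB K b (s • v, s)) with hqm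
  have hqpm : Measurable qp := by
    apply Measurable.lintegral_prod_right' (f := fun p : V × ℝ =>
            ENNReal.ofReal (|p.2| ^ (Module.finrank ℝ V - 1)) * ENNReal.ofReal (bpB K b (p.2 • p.1, p.2)))
    fun_prop
  have hqmm : Measurable qm := by
    apply Measurable.lintegral_prod_right' (f := fun p : V × ℝ =>
            ENNReal.ofReal (|p.2| ^ (Module.finrank ℝ V - 1)) * ENNReal.ofReal (-bpB K b (p.2 • p.1, p.2)))
    fun_prop
  have hq : ∀ v, qm v ≤ qp v := by
    intro v
    set a := b * (1 + ‖v‖ ^ 2) with ha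
    have ha0 : 0 < a := by positivity
    have h0 := bp_qpos hPL hK hconv hsymm (m := Module.finrank ℝ V - 1) (by omega) ha0 v
    have e0 : ∀ s : ℝ, Real.exp (-b * (‖s • v‖ ^ 2 + s ^ 2)) = Real.exp (-a * s ^ 2) := by
      intro s
      congr 1
      rw [norm_smul, mul_pow, Real.norm_eq_abs, sq_abs, ha]; ring
    have e : ∀ s : ℝ, |s| ^ (Module.finrank ℝ V - 1) * Real.exp (-a * s ^ 2) *
      ∫ z in K, Real.cos (⟪z.1, s • v⟫ + z.2 * s) =
        |s| ^ (Module.finrank ℝ V - 1) * bpB K b (s • v, s) := by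
      intro s
      simp only [bpB, e0, mul_assoc]
    rw [integral_congr_ae (Filter.Eventually.of_forall e)] at h0
    have hi : Integrable fun s : ℝ => |s| ^ (Module.finrank ℝ V - 1) * bpB K b (s • v, s) := by
      refine ((bp_w_int ha0 (Module.finrank ℝ V - 1)).mul_const (volume K).toReal).mono'
        (Measurable.aestronglyMeasurable (by fun_prop)) (Filter.Eventually.of_forall fun s => ?_)
      rw [norm_mul, Real.norm_of_nonneg (by positivity), mul_assoc]
      refine mul_le_mul_of_nonneg_left ((bpB_abs hK b _).trans ?_) (by positivity)
      simp only [e0, le_refl]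
    rw [integral_eq_lintegral_pos_part_sub_lintegral_neg_part hi, sub_nonneg] at h0
    have h0 := (ENNReal.toReal_le_toReal hi.neg.lintegral_lt_top.ne hi.lintegral_lt_top.ne).1 h0
    simp only [Pi.neg_apply] at h0
    simp only [← mul_neg] at h0
    simp only [ENNReal.ofReal_mul (pow_nonneg (abs_nonneg _) _)] at h0
    exact h0
  have sP : ∀ {M : Set (V × ℝ)}, IsCompact M → ∫⁻ x in M, P x =
      ∫⁻ v, volume {x : V | (x, -⟪x, v⟫) ∈ M} * qp v := fun {M} hM =>
    bp_swap_set hd hM.measurableSet (fun p => ENNReal.ofReal (bpB K b p)) (by fun_prop)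
  have sN : ∀ {M : Set (V × ℝ)}, IsCompact M → ∫⁻ x in M, N x =
      ∫⁻ v, volume {x : V | (x, -⟪x, v⟫) ∈ M} * qm v := fun {M} hM =>
    bp_swap_set hd hM.measurableSet (fun p => ENNReal.ofReal (-bpB K b p)) (by fun_prop)
  have hm : ∀ {M : Set (V × ℝ)}, IsCompact M → Measurable fun v : V => 
      volume {x : V | (x, -⟪x, v⟫) ∈ M} := fun {M} hM =>
    measurable_measure_prodMk_left (ν := (volume : Measure V))
      (s := {p : V × V | (p.2, -⟪p.2, p.1⟫) ∈ M}) 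
      ((by fun_prop : Measurable fun p : V × V => (p.2, -⟪p.2, p.1⟫)) hM.measurableSet)
  have hNfin : ∀ {M : Set (V × ℝ)}, IsCompact M → ∫⁻ x in M, N x ≠ ∞ := by
    intro M hM
    have h1 := ENNReal.mul_ne_top (a := volume K) hK.measure_lt_top.ne (bp_fin hd hM hb)
    refine (lt_of_le_of_lt ?_ h1.lt_top).ne
    have hmm : Measurable fun x : V × ℝ => (ENNReal.ofReal |x.2|⁻¹ * ∫⁻ ξ : V, ENNReal.ofReal
      (Real.exp (-b * (‖ξ‖ ^ 2 + (-⟪x.1, ξ⟫ / x.2) ^ 2)))) := by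
      apply Measurable.mul (by fun_prop)
      apply Measurable.lintegral_prod_right' (f := fun p : (V × ℝ) × V => 
        ENNReal.ofReal (Real.exp (-b * (‖p.2‖ ^ 2 + (-⟪p.1.1, p.2⟫ / p.1.2) ^ 2))))
      fun_prop
    rw [← lintegral_const_mul _ hmm]
    apply lintegral_mono
    intro x
    simp only [hN]
    rw [mul_left_comm]
    gcongr
    rw [← lintegral_const_mul _ (by fun_prop)]
    apply lintegral_mono
    intro ξ
    simp only
    rw [← ENNReal.ofReal_toReal hK.measure_lt_top.ne, ← ENNReal.ofReal_mul ENNReal.toReal_nonneg]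
    apply ENNReal.ofReal_le_ofReal
    rw [mul_comm]
    exact (neg_le_abs _).trans (bpB_abs hK b _)
  have id : ∀ {M : Set (V × ℝ)}, IsCompact M →
      ENNReal.ofReal (bpC V b) * (∫⁻ x in M, T x) + ∫⁻ x in M, N x = ∫⁻ x in M, P x := by
    intro M hM
    rw [← lintegral_const_mul _ hTm, ← lintegral_add_right _ hNm]
    apply lintegral_congr_ae
    exact ae_restrict_of_ae (bp_ae_snd.mono fun x hx => bp_pt hK hb x hx)
  have cmp : (∫⁻ x in K, P x) + ∫⁻ x in L, N x ≤ (∫⁻ x in L, P x) + ∫⁻ x in K, N x := by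
    have m1 : Measurable fun v : V => volume {x : V | (x, -⟪x, v⟫) ∈ L} * qm v := (hm hL).mul hqmm
    have m2 : Measurable fun v : V => volume {x : V | (x, -⟪x, v⟫) ∈ K} * qm v := (hm hK).mul hqmm
    rw [sP hK, sP hL, sN hK, sN hL, ← lintegral_add_right _ m1, ← lintegral_add_right _ m2]
    apply lintegral_mono
    intro v
    simp only
    obtain ⟨c, hc⟩ := exists_add_of_le (hq v)
    rw [hc, mul_add, mul_add]
    calc _ ≤ volume {x : V | (x, -⟪x, v⟫) ∈ K} * qm v + volume {x : V | (x, -⟪x, v⟫) ∈ L} * c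
        + volume {x : V | (x, -⟪x, v⟫) ∈ L} * qm v := 
          add_le_add (add_le_add le_rfl (mul_le_mul' (hsec v) le_rfl)) le_rfl
      _ = _ := by ring
  rw [← id hK, ← id hL] at cmp
  have hfin := ENNReal.add_ne_top.2 ⟨hNfin hK, hNfin hL⟩
  have c2 : ENNReal.ofReal (bpC V b) * (∫⁻ x in K, T x) ≤ ENNReal.ofReal (bpC V b) * (∫⁻ x in L, T x) := by
    rw [← ENNReal.add_le_add_iff_right hfin]
    calc _ = _ := (add_assoc _ _ _).symm
      _ ≤ _ := cmp
      _ = _ := by ring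
  exact (ENNReal.mul_le_mul_iff_right (by simpa using hC) ENNReal.ofReal_ne_top).1 c2

end FF2



section GG
variable {V : Type*} [NormedAddCommGroup V] [InnerProductSpace ℝ V] [FiniteDimensional ℝ V]
  [MeasurableSpace V] [BorelSpace V]

/-- length of the ray section -/
noncomputable def bpl (K : Set (V × ℝ)) (x : V × ℝ) : ℝ≥0∞ := volume {t : ℝ | t • x ∈ K}

/-- Gaussian weight -/
noncomputable def bpw (y : V × ℝ) : ℝ≥0∞ := ENNReal.ofReal (Real.exp (-(‖y.1‖ ^ 2 + y.2 ^ 2)))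

instance bp_haar : (volume : Measure (V × ℝ)).IsAddHaarMeasure := by
  rw [Measure.volume_eq_prod]; infer_instance

lemma bpw_meas : Measurable (bpw : V × ℝ → ℝ≥0∞) := by unfold bpw; fun_prop

lemma bp_gauss_half {a : ℝ} (ha : 0 < a) :
    Integrable fun y : V × ℝ => Real.exp (-a * (‖y.1‖ ^ 2 + y.2 ^ 2)) := by
  have := (bp_gauss_int (V := V) ha).mul_prod (integrable_exp_neg_mul_sq ha)
  rw [← Measure.volume_eq_prod] at this
  refine this.congr (Filter.Eventually.of_forall fun y => ?_)
  simp only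
  rw [← Real.exp_add]; congr 1; ring

lemma bpw_fin : ∫⁻ y : V × ℝ, bpw y ≠ ∞ := by
  have := (bp_gauss_half (V := V) one_pos).lintegral_lt_top.ne
  simpa [bpw] using this

lemma bpw_pos : ∫⁻ y : V × ℝ, bpw y ≠ 0 := by
  intro h
  rw [lintegral_eq_zero_iff bpw_meas] at h
  have : ∀ᵐ y : V × ℝ, False := by
    filter_upwards [h] with y hy
    simp only [bpw, Pi.zero_apply, ENNReal.ofReal_eq_zero] at hy
    exact absurd hy (not_le.2 (Real.exp_pos _))
  rw [Filter.eventually_false_iff_eq_bot, ae_eq_bot] at this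
  exact NeZero.ne (volume : Measure (V × ℝ)) this

lemma bpw_fin' {R : ℝ} (hR : 0 ≤ R) :
    ∫⁻ y : V × ℝ, ENNReal.ofReal (2 * (R + ‖y‖)) * bpw y ≠ ∞ := by
  have h := ((bp_gauss_half (V := V) (a := 1 / 2) (by norm_num)).const_mul (2 * (R + 1))).lintegral_lt_top
  refine (lt_of_le_of_lt (lintegral_mono fun y => ?_) h).ne
  simp only [bpw]
  rw [← ENNReal.ofReal_mul (by positivity)]
  apply ENNReal.ofReal_le_ofReal
  set q := ‖y.1‖ ^ 2 + y.2 ^ 2 with hq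
  have h1 : ‖y‖ ^ 2 ≤ q := bp_norm_le y
  have h2 : 1 + q / 2 ≤ Real.exp (q / 2) := by linarith [Real.add_one_le_exp (q / 2)]
  have h3 : R + ‖y‖ ≤ (R + 1) * Real.exp (q / 2) := by
    have q0 : 0 ≤ q := by positivity
    nlinarith [sq_nonneg (‖y‖ - 1), mul_le_mul_of_nonneg_left h2 hR, mul_nonneg hR q0]
  have h4 : Real.exp (-(1 / 2) * q) = Real.exp (q / 2) * Real.exp (-q) := by
    rw [← Real.exp_add]; congr 1; ring
  rw [h4, mul_assoc, mul_assoc, ← mul_assoc (R + 1)]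
  gcongr

lemma bp_len {x : V × ℝ} (hx : x ≠ 0) (r : ℝ) :
    volume {t : ℝ | ‖t • x‖ ≤ r} = ENNReal.ofReal ‖x‖⁻¹ * ENNReal.ofReal (2 * r) := by
  have hx0 : 0 < ‖x‖ := norm_pos_iff.2 hx
  have : {t : ℝ | ‖t • x‖ ≤ r} = Icc (-(r / ‖x‖)) (r / ‖x‖) := by
    ext t
    rw [mem_Icc, ← abs_le, le_div_iff₀ hx0]
    simp only [mem_ofPred_eq, norm_smul, Real.norm_eq_abs]
  rw [this, Real.volume_Icc, ← ENNReal.ofReal_mul (by positivity)]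
  congr 1; field_simp; ring

lemma bp_sub (F : V × ℝ → ℝ≥0∞) (hF : Measurable F) (a : V × ℝ) {η : ℝ} (hη : 0 < η) :
    ∫⁻ z, F z = ENNReal.ofReal (η ^ Module.finrank ℝ (V × ℝ)) * ∫⁻ y, F (a - η • y) := by
  rw [← lintegral_sub_left_eq_self F a]
  have h := lintegral_map (μ := (volume : Measure (V × ℝ))) (f := fun y => F (a - y)) 
    (by fun_prop) (measurable_const_smul η)
  rw [Measure.map_addHaar_smul _ hη.ne', lintegral_smul_measure, smul_eq_mul] at h
  rw [← h, ← mul_assoc, ← ENNReal.ofReal_mul (by positivity), abs_of_pos (by positivity),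
    mul_inv_cancel₀ (by positivity), ENNReal.ofReal_one, one_mul]

/-- integrand -/
noncomputable def bpF (K : Set (V × ℝ)) (η : ℝ) (p : ((V × ℝ) × (V × ℝ)) × ℝ) : ℝ≥0∞ :=
  K.indicator 1 (p.2 • p.1.1 - η • p.1.2) * bpw p.1.2

lemma bpF_meas {K : Set (V × ℝ)} (hK : MeasurableSet K) (η : ℝ) : Measurable (bpF K η) := by
  unfold bpF
  have := (bpw_meas (V := V))
  apply Measurable.mul
  · exact (measurable_one.indicator hK).comp (by fun_prop)
  · fun_prop

lemma bp_J {K L : Set (V × ℝ)} (hK : IsCompact K) {η : ℝ} (hη : 0 < η) :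
    ∫⁻ x in L, ∫⁻ z in K, ∫⁻ t : ℝ, ENNReal.ofReal (bpG (η ^ 2 / 4) t x z) =
    ENNReal.ofReal (η ^ Module.finrank ℝ (V × ℝ)) * 
      ∫⁻ p, bpF K η p ∂(((volume.restrict L).prod volume).prod volume) := by
  have hKm := hK.measurableSet
  have hFm := bpF_meas hKm η
  have : IsFiniteMeasure ((volume : Measure (V × ℝ)).restrict K) := ⟨by simpa using hK.measure_lt_top⟩
  have hm2 : Measurable fun p : (V × ℝ) × (V × ℝ) => ∫⁻ t : ℝ, bpF K η (p, t) := hFm.lintegral_prod_right'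
  rw [lintegral_prod _ hFm.aemeasurable, lintegral_prod _ hm2.aemeasurable,
    ← lintegral_const_mul _ hm2.lintegral_prod_right']
  congr 1; ext x
  have s1 : ∫⁻ y : V × ℝ, ∫⁻ t : ℝ, bpF K η ((x, y), t) = ∫⁻ t : ℝ, ∫⁻ y : V × ℝ, bpF K η ((x, y), t) := by
    rw [lintegral_lintegral_swap]
    apply Measurable.aemeasurable
    simp only [Function.uncurry_def]
    fun_prop
  have s2 : ∫⁻ z in K, ∫⁻ t : ℝ, ENNReal.ofReal (bpG (η ^ 2 / 4) t x z) =
      ∫⁻ t : ℝ, ∫⁻ z in K, ENNReal.ofReal (bpG (η ^ 2 / 4) t x z) := by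
    rw [lintegral_lintegral_swap]
    apply Measurable.aemeasurable
    simp only [Function.uncurry_def]
    unfold bpG; fun_prop
  rw [s1, s2, ← lintegral_const_mul]
  · congr 1; ext t
    rw [← lintegral_indicator hKm, bp_sub _ _ (t • x) hη]
    · congr 1
      congr 1; ext y
      simp only [bpF, indicator]
      split_ifs
      · simp only [Pi.one_apply, one_mul, bpG, bpw]
        congr 2
        simp only [Prod.fst_sub, Prod.smul_fst, Prod.snd_sub, Prod.smul_snd, smul_eq_mul, sub_sub_cancel,
          norm_smul, mul_pow, Real.norm_eq_abs, sq_abs]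
        field_simp
      · simp
    · refine Measurable.indicator ?_ hKm
      unfold bpG; fun_prop
  · apply Measurable.lintegral_prod_right' (f := fun p : ℝ × (V × ℝ) => bpF K η ((x, p.2), p.1))
    fun_prop

lemma bp_frontier {K L : Set (V × ℝ)} (hconv : Convex ℝ K) :
    ∀ᵐ p ∂((((volume : Measure (V × ℝ)).restrict L).prod (volume : Measure (V × ℝ))).prod (volume : Measure ℝ)),
      p.2 • p.1.1 ∉ frontier K := by
  have hS : MeasurableSet {p : ((V × ℝ) × (V × ℝ)) × ℝ | p.2 • p.1.1 ∈ frontier K} :=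
    (by fun_prop : Measurable fun p : ((V × ℝ) × (V × ℝ)) × ℝ => p.2 • p.1.1) isClosed_frontier.measurableSet
  rw [ae_iff]
  simp only [not_not]
  rw [Measure.prod_apply_symm hS, lintegral_eq_zero_iff (measurable_measure_prodMk_right hS)]
  have h0 : ∀ᵐ s : ℝ, s ≠ 0 := by simp [ae_iff]
  filter_upwards [h0] with t ht
  have e : (fun x => (x, t)) ⁻¹' {p : ((V × ℝ) × (V × ℝ)) × ℝ | p.2 • p.1.1 ∈ frontier K} =
    ((fun x : V × ℝ => t • x) ⁻¹' frontier K) ×ˢ univ := by ext; simp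
  rw [e, Measure.prod_prod]
  have : (volume : Measure (V × ℝ)) ((fun x : V × ℝ => t • x) ⁻¹' frontier K) = 0 := by
    rw [Measure.addHaar_preimage_smul _ ht, hconv.addHaar_frontier volume, mul_zero]
  have := Measure.restrict_le_self.absolutelyContinuous this (μ := volume.restrict L)
  rw [this]; simp

lemma bp_lim (hd : 1 ≤ Module.finrank ℝ V) {K L : Set (V × ℝ)} (hK : IsCompact K) (hconv : Convex ℝ K)
    (hL : IsCompact L) :
    Filter.Tendsto (fun η => ∫⁻ p, bpF K η p ∂(((volume.restrict L).prod volume).prod volume))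
      (nhdsWithin 0 (Ioi 0)) (nhds ((∫⁻ x in L, bpl K x) * ∫⁻ y : V × ℝ, bpw y)) := by
  have hKm := hK.measurableSet
  obtain ⟨R, hR0, hR⟩ := hK.isBounded.exists_pos_norm_le
  have hwm := bpw_meas (V := V)
  have hl : Measurable (bpl K) := by
    unfold bpl
    exact measurable_measure_prodMk_left (ν := (volume : Measure ℝ))
      (s := {p : (V × ℝ) × ℝ | p.2 • p.1 ∈ K}) 
      ((by fun_prop : Measurable fun p : (V × ℝ) × ℝ => p.2 • p.1) hKm)
  have e0 : ∫⁻ p, bpF K 0 p ∂(((volume.restrict L).prod volume).prod volume) = 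
      (∫⁻ x in L, bpl K x) * ∫⁻ y : V × ℝ, bpw y := by
    rw [lintegral_prod _ (bpF_meas hKm 0).aemeasurable,
      ← lintegral_prod_mul hl.aemeasurable hwm.aemeasurable]
    congr 1; ext p
    simp only [bpF, zero_smul, sub_zero]
    have hms : MeasurableSet {t : ℝ | t • p.1 ∈ K} := (by fun_prop : Measurable fun t : ℝ => t • p.1) hKm
    have := lintegral_indicator_one (μ := volume) hms
    rw [bpl, ← this, lintegral_mul_const]
    · rfl
    · exact measurable_one.indicator hms
  rw [← e0]
  set D : ((V × ℝ) × (V × ℝ)) × ℝ → ℝ≥0∞ := fun p =>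
    {q : ((V × ℝ) × (V × ℝ)) × ℝ | ‖q.2 • q.1.1‖ ≤ R + ‖q.1.2‖}.indicator 1 p * bpw p.1.2 with hD
  have hSm : MeasurableSet {q : ((V × ℝ) × (V × ℝ)) × ℝ | ‖q.2 • q.1.1‖ ≤ R + ‖q.1.2‖} :=
    measurableSet_le (by fun_prop) (by fun_prop)
  have hDm : Measurable D := by
    apply Measurable.mul (measurable_one.indicator hSm)
    fun_prop
  refine tendsto_lintegral_filter_of_dominated_convergence D
    (Filter.Eventually.of_forall fun η => bpF_meas hKm η) ?_ ?_ ?_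
  · filter_upwards [Ioc_mem_nhdsGT (zero_lt_one' ℝ)] with η hη
    refine Filter.Eventually.of_forall fun p => ?_
    simp only [bpF, hD]
    refine mul_le_mul' ?_ le_rfl
    by_cases h : p.2 • p.1.1 - η • p.1.2 ∈ K
    · have h1 := hR _ h
      have h2 : ‖p.2 • p.1.1‖ ≤ R + ‖p.1.2‖ := by
        have h3 : ‖η • p.1.2‖ ≤ ‖p.1.2‖ := by
          rw [norm_smul, Real.norm_of_nonneg hη.1.le]
          exact mul_le_of_le_one_left (norm_nonneg _) hη.2
        have h4 := norm_add_le (p.2 • p.1.1 - η • p.1.2) (η • p.1.2)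
        rw [sub_add_cancel] at h4
        linarith
      rw [indicator_of_mem h, indicator_of_mem (show p ∈ {q : ((V × ℝ) × (V × ℝ)) × ℝ | ‖q.2 • q.1.1‖ ≤ R + ‖q.1.2‖} from h2)]
      simp
    · rw [indicator_of_notMem h]; exact bot_le
  · rw [lintegral_prod _ hDm.aemeasurable]
    have hfin : (∫⁻ x in L, ENNReal.ofReal ‖x‖⁻¹) * ∫⁻ y : V × ℝ, ENNReal.ofReal (2 * (R + ‖y‖)) * bpw y ≠ ∞ :=
      ENNReal.mul_ne_top (bp_inv_norm hd hL.isBounded hL.measurableSet) (bpw_fin' hR0.le)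
    rw [← lintegral_prod_mul (by fun_prop) (by fun_prop)] at hfin
    refine (lt_of_le_of_lt (lintegral_mono_ae ?_) hfin.lt_top).ne
    have hx : ∀ᵐ p : (V × ℝ) × (V × ℝ) ∂((volume.restrict L).prod volume), p.1 ≠ 0 := by
      refine Measure.quasiMeasurePreserving_fst.ae (p := fun x => x ≠ 0) ?_
      refine ae_restrict_of_ae (bp_ae_snd.mono fun x hx h => hx (by simp [h]))
    filter_upwards [hx] with p hp
    simp only [hD]
    have hms : MeasurableSet {t : ℝ | ‖t • p.1‖ ≤ R + ‖p.2‖} :=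
      measurableSet_le (by fun_prop) (by fun_prop)
    rw [lintegral_mul_const, ← mul_assoc, ← bp_len hp, ← lintegral_indicator_one hms]
    · rfl
    · exact (measurable_one.indicator hms)
  · filter_upwards [bp_frontier (L := L) hconv] with p hp
    have hev : ∀ᶠ y in nhds (p.2 • p.1.1), (y ∈ K ↔ p.2 • p.1.1 ∈ K) := by
      by_cases h : p.2 • p.1.1 ∈ K
      · have : p.2 • p.1.1 ∈ interior K := by
          by_contra h'
          exact hp ⟨subset_closure h, h'⟩
        filter_upwards [mem_interior_iff_mem_nhds.1 this] with y hy
        simp [h, hy]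
      · filter_upwards [hK.isClosed.isOpen_compl.mem_nhds h] with y hy
        simp only [h, iff_false]; exact hy
    have ht : Filter.Tendsto (fun η : ℝ => p.2 • p.1.1 - η • p.1.2) (nhdsWithin 0 (Ioi 0)) (nhds (p.2 • p.1.1)) := by
      have : Continuous fun η : ℝ => p.2 • p.1.1 - η • p.1.2 := by fun_prop
      have := this.tendsto 0
      simp only [zero_smul, sub_zero] at this
      exact this.mono_left nhdsWithin_le_nhds
    apply tendsto_const_nhds.congr'
    filter_upwards [ht.eventually hev] with η hη
    have z0 : p.2 • p.1.1 - (0 : ℝ) • p.1.2 = p.2 • p.1.1 := by rw [zero_smul, sub_zero]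
    simp only [bpF, z0]
    by_cases h : p.2 • p.1.1 ∈ K
    · rw [indicator_of_mem h, indicator_of_mem (hη.2 h)]; rfl
    · rw [indicator_of_notMem h, indicator_of_notMem fun h' => h (hη.1 h')]

lemma bp_len_ineq (hd : 1 ≤ Module.finrank ℝ V) (hd3 : Module.finrank ℝ V ≤ 3)
    (hPL : BPPL (volume : Measure V)) {K L : Set (V × ℝ)} (hK : IsCompact K)
    (hconv : Convex ℝ K) (hsymm : ∀ z ∈ K, -z ∈ K) (hL : IsCompact L)
    (hsec : ∀ v : V, volume {x : V | (x, -⟪x, v⟫) ∈ K} ≤ volume {x : V | (x, -⟪x, v⟫) ∈ L}) :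
    ∫⁻ x in K, bpl K x ≤ ∫⁻ x in L, bpl K x := by
  rw [← ENNReal.mul_le_mul_iff_left bpw_pos (bpw_fin (V := V))]
  refine le_of_tendsto_of_tendsto (bp_lim hd hK hconv hK) (bp_lim hd hK hconv hL) ?_
  filter_upwards [self_mem_nhdsWithin] with η hη
  have hη' : 0 < η := hη
  have := bp_fixed hd hd3 hPL hK hconv hsymm hL hsec (b := η ^ 2 / 4) (by positivity)
  rw [bp_J hK hη', bp_J hK hη'] at this
  exact (ENNReal.mul_le_mul_iff_right (by simp; positivity) ENNReal.ofReal_ne_top).1 this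

lemma bp_conclude (hd : 1 ≤ Module.finrank ℝ V) (hd3 : Module.finrank ℝ V ≤ 3)
    (hPL : BPPL (volume : Measure V)) {K L : Set (V × ℝ)} (hK : IsCompact K)
    (hconv : Convex ℝ K) (hsymm : ∀ z ∈ K, -z ∈ K) (hL : IsCompact L)
    (hsec : ∀ v : V, volume {x : V | (x, -⟪x, v⟫) ∈ K} ≤ volume {x : V | (x, -⟪x, v⟫) ∈ L}) :
    volume K ≤ volume L := by
  have h := bp_len_ineq hd hd3 hPL hK hconv hsymm hL hsec
  have hbal : ∀ c : ℝ, |c| ≤ 1 → ∀ z ∈ K, c • z ∈ K := by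
    intro c hc z hz
    rw [abs_le] at hc
    have := hconv hz (hsymm z hz) (a := (1 + c) / 2) (b := (1 - c) / 2) (by linarith) (by linarith) (by ring)
    convert this using 1
    rw [smul_neg, ← sub_eq_add_neg, ← sub_smul]; congr 1; ring
  obtain ⟨R, hR0, hR⟩ := hK.isBounded.exists_pos_norm_le
  have hfin : ∫⁻ x in K, bpl K x ≠ ∞ := by
    have h1 := ENNReal.mul_ne_top (bp_inv_norm hd hK.isBounded hK.measurableSet) (ENNReal.ofReal_ne_top (r := 2 * R))
    rw [← lintegral_mul_const _ (by fun_prop)] at h1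
    refine (lt_of_le_of_lt (lintegral_mono_ae ?_) h1.lt_top).ne
    refine ae_restrict_of_ae (bp_ae_snd.mono fun x hx => ?_)
    have hx0 : x ≠ 0 := fun h => hx (by simp [h])
    rw [← bp_len hx0]
    exact measure_mono fun t ht => hR _ ht
  have lo : ∀ x ∈ K, 2 ≤ bpl K x := by
    intro x hx
    have : volume (Icc (-1:ℝ) 1) = 2 := by rw [Real.volume_Icc]; norm_num
    rw [← this]
    exact measure_mono fun t ht => hbal t (abs_le.2 ht) x hx
  have hi : ∀ x ∉ K, bpl K x ≤ 2 := by
    intro x hx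
    have : volume (Icc (-1:ℝ) 1) = 2 := by rw [Real.volume_Icc]; norm_num
    rw [← this]
    refine measure_mono fun t ht => abs_le.1 ?_
    by_contra hc
    rw [not_le] at hc
    apply hx
    have ht0 : t ≠ 0 := by rintro rfl; simp at hc; linarith
    have := hbal t⁻¹ (by rw [abs_inv]; exact inv_le_one_of_one_le₀ hc.le) _ ht
    rwa [inv_smul_smul₀ ht0] at this
  have hKm := hK.measurableSet
  have hLm := hL.measurableSet
  have hc : (∫⁻ x in K ∩ L, bpl K x) ≠ ∞ := 
    (lt_of_le_of_lt (lintegral_mono_set inter_subset_left) hfin.lt_top).ne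
  rw [← lintegral_inter_add_sdiff (μ := volume) (bpl K) K hLm, ← lintegral_inter_add_sdiff (μ := volume) (bpl K) L hKm,
    inter_comm L K, ENNReal.add_le_add_iff_left hc] at h
  have h2 : 2 * volume (K \ L) ≤ 2 * volume (L \ K) := by
    calc 2 * volume (K \ L) = ∫⁻ x in K \ L, 2 := by simp
      _ ≤ ∫⁻ x in K \ L, bpl K x := setLIntegral_mono' (hKm.diff hLm) fun x hx => lo x hx.1
      _ ≤ ∫⁻ x in L \ K, bpl K x := h
      _ ≤ ∫⁻ x in L \ K, 2 := setLIntegral_mono' (hLm.diff hKm) fun x hx => hi x hx.2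
      _ = _ := by simp
  have h3 := (ENNReal.mul_le_mul_iff_right two_ne_zero ENNReal.ofNat_ne_top).1 h2
  rw [← measure_inter_add_sdiff K hLm, ← measure_inter_add_sdiff L hKm, inter_comm L K]
  gcongr

end GG



section HH

lemma bp_haar_eq {G : Type*} [NormedAddCommGroup G] [NormedSpace ℝ G] [FiniteDimensional ℝ G]
    [MeasurableSpace G] [BorelSpace G] (μ ν : Measure G) [μ.IsAddHaarMeasure] [ν.IsAddHaarMeasure] :
    ∃ c : ℝ≥0∞, c ≠ 0 ∧ c ≠ ∞ ∧ ∀ s, μ s = c * ν s := by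
  refine ⟨(μ.addHaarScalarFactor ν : ℝ≥0∞), ?_, ENNReal.coe_ne_top, fun s => ?_⟩
  · exact_mod_cast (Measure.addHaarScalarFactor_pos_of_isAddHaarMeasure μ ν).ne'
  · conv_lhs => rw [Measure.isAddLeftInvariant_eq_smul μ ν]
    rfl

lemma bp_haus {V X : Type*} [NormedAddCommGroup V] [NormedSpace ℝ V] [FiniteDimensional ℝ V]
    [MeasurableSpace V] [BorelSpace V] (vol : Measure V) [vol.IsAddHaarMeasure]
    [NormedAddCommGroup X] [NormedSpace ℝ X]
    [MeasurableSpace X] [BorelSpace X] (j : V →ₗ[ℝ] X) (hj : Function.Injective j) :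
    ∃ c : ℝ≥0∞, c ≠ 0 ∧ c ≠ ∞ ∧ ∀ s : Set V, μH[(Module.finrank ℝ V : ℝ)] (j '' s) = c * vol s := by
  set e := (LinearEquiv.ofInjective j hj).toContinuousLinearEquiv with he
  have hW : Module.finrank ℝ j.range = Module.finrank ℝ V := LinearMap.finrank_range_of_inj hj
  have h1 : (μH[(Module.finrank ℝ V : ℝ)] : Measure j.range).IsAddHaarMeasure := by
    rw [← hW]; infer_instance
  have h2 := e.symm.isAddHaarMeasure_map (μH[(Module.finrank ℝ V : ℝ)] : Measure j.range)
  obtain ⟨c, hc0, hc1, hc⟩ := bp_haar_eq (Measure.map e.symm (μH[(Module.finrank ℝ V : ℝ)] : Measure j.range)) vol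
  refine ⟨c, hc0, hc1, fun s => ?_⟩
  have hme : MeasurableEmbedding (e.symm : j.range → V) := e.symm.toHomeomorph.measurableEmbedding
  rw [← hc, hme.map_apply]
  have : j '' s = Subtype.val '' (e.symm ⁻¹' s) := by
    ext y
    constructor
    · rintro ⟨x, hx, rfl⟩
      exact ⟨e x, by simpa using hx, rfl⟩
    · rintro ⟨w, hw, rfl⟩
      refine ⟨e.symm w, hw, ?_⟩
      exact congrArg Subtype.val (e.apply_symm_apply w)
  rw [this, isometry_subtype_coe.hausdorffMeasure_image (Or.inl (by positivity))]

/-- splitting off a coordinate -/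
noncomputable def bpA (m : ℕ) : (EuclideanSpace ℝ (Fin m) × ℝ) ≃ₗ[ℝ] EuclideanSpace ℝ (Fin (m + 1)) where
  toFun p := WithLp.toLp 2 (Fin.cons p.2 (fun i => p.1 i))
  invFun y := (WithLp.toLp 2 (fun i => y i.succ), y 0)
  map_add' p q := by
    ext i; refine Fin.cases ?_ (fun i => ?_) i <;> simp
  map_smul' c p := by
    ext i; refine Fin.cases ?_ (fun i => ?_) i <;> simp
  left_inv p := by ext <;> simp
  right_inv y := by
    ext i; refine Fin.cases ?_ (fun i => ?_) i <;> simp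

lemma bpA_inner {m : ℕ} (p q : EuclideanSpace ℝ (Fin m) × ℝ) :
    ⟪bpA m p, bpA m q⟫ = ⟪p.1, q.1⟫ + p.2 * q.2 := by
  simp only [PiLp.inner_apply, Fin.sum_univ_succ]
  simp [bpA]
  ring

lemma bp_sec {m : ℕ} {K L : Set (EuclideanSpace ℝ (Fin (m + 1)))}
    (hsec : ∀ ξ : EuclideanSpace ℝ (Fin (m + 1)), ‖ξ‖ = 1 →
      μH[(m : ℝ)] (K ∩ {x : EuclideanSpace ℝ (Fin (m + 1)) | ⟪x, ξ⟫ = 0})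
        ≤ μH[(m : ℝ)] (L ∩ {x : EuclideanSpace ℝ (Fin (m + 1)) | ⟪x, ξ⟫ = 0}))
    (v : EuclideanSpace ℝ (Fin m)) :
    volume {x : EuclideanSpace ℝ (Fin m) | (x, -⟪x, v⟫) ∈ bpA m ⁻¹' K} ≤
    volume {x : EuclideanSpace ℝ (Fin m) | (x, -⟪x, v⟫) ∈ bpA m ⁻¹' L} := by
  set j : EuclideanSpace ℝ (Fin m) →ₗ[ℝ] EuclideanSpace ℝ (Fin (m + 1)) :=
    (bpA m).toLinearMap ∘ₗ (LinearMap.id.prod (-(innerₛₗ ℝ v))) with hj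
  have hj' : ∀ x, j x = bpA m (x, -⟪x, v⟫) := by
    intro x
    simp [hj, real_inner_comm]
  have hinj : Function.Injective j := by
    intro x y hxy
    rw [hj', hj'] at hxy
    exact congrArg Prod.fst ((bpA m).injective hxy)
  obtain ⟨c, hc0, hc1, hc⟩ := bp_haus (volume : Measure (EuclideanSpace ℝ (Fin m))) j hinj
  set ξ₀ := bpA m (v, 1) with hξ₀
  have hne : ξ₀ ≠ 0 := by
    intro h
    have := congrArg Prod.snd ((bpA m).map_eq_zero_iff.1 h)
    simp at this
  have hsl : ∀ M : Set (EuclideanSpace ℝ (Fin (m + 1))),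
      M ∩ {x : EuclideanSpace ℝ (Fin (m + 1)) | ⟪x, ‖ξ₀‖⁻¹ • ξ₀⟫ = 0} =
      j '' {x : EuclideanSpace ℝ (Fin m) | (x, -⟪x, v⟫) ∈ bpA m ⁻¹' M} := by
    intro M
    ext y
    constructor
    · rintro ⟨hy, h0⟩
      simp only [mem_ofPred_eq, inner_smul_right, mul_eq_zero, inv_eq_zero, norm_eq_zero, hne, false_or] at h0
      obtain ⟨⟨x, τ⟩, rfl⟩ := (bpA m).surjective y
      rw [hξ₀, bpA_inner] at h0
      simp only [mul_one] at h0
      have : τ = -⟪x, v⟫ := by linarith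
      subst this
      exact ⟨x, hy, hj' x⟩
    · rintro ⟨x, hx, rfl⟩
      rw [hj']
      refine ⟨hx, ?_⟩
      simp [inner_smul_right, hξ₀, bpA_inner]
  have h := hsec (‖ξ₀‖⁻¹ • ξ₀) (norm_smul_inv_norm hne)
  rw [hsl, hsl] at h
  rw [finrank_euclideanSpace_fin] at hc
  rw [hc, hc] at h
  exact (ENNReal.mul_le_mul_iff_right hc0 hc1).1 h

end HH

/-- Affirmative answer to the Busemann–Petty problem for `2 ≤ n ≤ 4`: if `K` and `L`
are origin-symmetric convex bodies in `ℝⁿ` such that every central hyperplane section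
of `K` has `(n−1)`-dimensional Hausdorff measure at most that of the corresponding
section of `L`, then `vol_n(K) ≤ vol_n(L)`. -/
theorem busemann_petty_affirmative (n : ℕ) (hn2 : 2 ≤ n) (hn4 : n ≤ 4)
    (K L : Set (EuclideanSpace ℝ (Fin n)))
    (hKcomp : IsCompact K) (hKconv : Convex ℝ K)
    (hKint : (interior K).Nonempty) (hKsymm : K = -K)
    (hLcomp : IsCompact L) (hLconv : Convex ℝ L)
    (hLint : (interior L).Nonempty) (hLsymm : L = -L)
    (hsec : ∀ ξ : EuclideanSpace ℝ (Fin n), ‖ξ‖ = 1 →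
      μH[(n : ℝ) - 1] (K ∩ {x : EuclideanSpace ℝ (Fin n) | ⟪x, ξ⟫ = 0})
        ≤ μH[(n : ℝ) - 1] (L ∩ {x : EuclideanSpace ℝ (Fin n) | ⟪x, ξ⟫ = 0})) :
    volume K ≤ volume L := by
  obtain ⟨m, rfl⟩ : ∃ m, n = m + 1 := ⟨n - 1, by omega⟩
  have hcast : (((m + 1 : ℕ) : ℝ) - 1) = (m : ℝ) := by push_cast; ring
  rw [hcast] at hsec
  set A := (bpA m).toContinuousLinearEquiv with hA
  have hcomp : ∀ {M : Set (EuclideanSpace ℝ (Fin (m + 1)))}, IsCompact M → IsCompact (bpA m ⁻¹' M) :=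
    fun {M} hM => A.toHomeomorph.isCompact_preimage.2 hM
  have hconc := bp_conclude (V := EuclideanSpace ℝ (Fin m)) (K := bpA m ⁻¹' K) (L := bpA m ⁻¹' L)
    (by rw [finrank_euclideanSpace_fin]; omega) (by rw [finrank_euclideanSpace_fin]; omega)
    (bp_pl_euc m) (hcomp hKcomp) (hKconv.linear_preimage (bpA m).toLinearMap)
    (by
      intro z hz
      rw [hKsymm]
      simpa using hz)
    (hcomp hLcomp) (bp_sec hsec)
  have := A.isAddHaarMeasure_map (volume : Measure (EuclideanSpace ℝ (Fin m) × ℝ))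
  obtain ⟨c, hc0, hc1, hc⟩ := bp_haar_eq (Measure.map A volume)
    (volume : Measure (EuclideanSpace ℝ (Fin (m + 1))))
  have hmap : ∀ M : Set (EuclideanSpace ℝ (Fin (m + 1))), volume (bpA m ⁻¹' M) = c * volume M := by
    intro M
    have hme : MeasurableEmbedding A := A.toHomeomorph.measurableEmbedding
    rw [← hc, hme.map_apply]
    rfl
  rw [hmap, hmap] at hconc
  exact (ENNReal.mul_le_mul_iff_right hc0 hc1).1 hconc
end

section
/- For every integer n ≥ 5 there exist origin-symmetric convex bodies K and L in ℝⁿ such that vol_{n−1}(K ∩ ξ^⊥) ≤ vol_{n−1}(L ∩ ξ^⊥) for every ξ ∈ S^{n−1}, where ξ^⊥ = {x ∈ ℝⁿ : ⟨x,ξ⟩ = 0} and vol_{n−1} denotes (n−1)-dimensional Hausdorff measure, and yet vol_n(K) > vol_n(L), where vol_n denotes Lebesgue measure on ℝⁿ. (Negative answer to the Busemann–Petty problem for n ≥ 5.) -/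
open MeasureTheory Set
open scoped RealInnerProductSpace ENNReal

lemma bp_tangent_aux (A B : ℝ) (hA : 0 ≤ A) (hB : 0 ≤ B) (k : ℕ) :
    2 * B ^ (k+2) + (k+2 : ℝ) * B ^ k * (A^2 - B^2) ≤ 2 * A ^ (k+2) := by
  induction k with
  | zero => simp; linarith
  | succ k ih =>
    have h1 : 0 ≤ (A - B) * (A ^ (k+1) - B ^ (k+1)) := by
      rcases le_total A B with h | h
      · exact mul_nonneg_of_nonpos_of_nonpos (by linarith)
          (by linarith [pow_le_pow_left₀ hA h (k+1)])
      · exact mul_nonneg (by linarith) (by linarith [pow_le_pow_left₀ hB h (k+1)])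
    have hAk : 0 ≤ A ^ k := by positivity
    have hBk : 0 ≤ B ^ k := by positivity
    have h2 := mul_le_mul_of_nonneg_left ih hA
    have h3 : 0 ≤ (k+2 : ℝ) * B ^ k * ((A + B) * (A - B)^2) * 1 := by positivity
    have h4 : 0 ≤ B ^ k * (A - B)^2 * B := by positivity
    have h5 : 0 ≤ (k:ℝ) * (B ^ k * (A - B)^2 * B) := by positivity
    have h6 : 0 ≤ (k:ℝ) * (B ^ k * (A - B)^2 * A) := by positivity
    have h7 : 0 ≤ (B ^ k * (A - B)^2 * A) := by positivity
    push_cast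
    ring_nf at *
    nlinarith

lemma bp_tangent (y y0 : ℝ) (k : ℕ) (hk : 1 ≤ k) :
    √y0 ^ (k+2) + ((k+2 : ℝ)/2) * (√y0 ^ k * (y - y0)) ≤ √y ^ (k+2) := by
  rcases le_total y0 0 with h | h
  · rw [Real.sqrt_eq_zero_of_nonpos h]
    rw [zero_pow (by omega), zero_pow (by omega)]
    have : 0 ≤ √y ^ (k+2) := by positivity
    simp
  · have h1 := bp_tangent_aux (√y) (√y0) (Real.sqrt_nonneg _) (Real.sqrt_nonneg _) k
    have h2 : √y0 ^ 2 = y0 := Real.sq_sqrt h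
    have h3 : y ≤ √y ^ 2 := by
      rcases le_total y 0 with h' | h'
      · exact h'.trans (by positivity)
      · rw [Real.sq_sqrt h']
    have h4 : (k+2 : ℝ) * √y0 ^ k * (y - y0) ≤ (k+2 : ℝ) * √y0 ^ k * (√y^2 - √y0^2) := by
      apply mul_le_mul_of_nonneg_left _ (by positivity)
      rw [h2]; linarith
    nlinarith

lemma bp_kappa (P : ℕ) (hP : 1 ≤ P) (x : ℝ) (hx : 0 ≤ x) (hx1 : x ≤ 1) :
    ∫ t in (0:ℝ)..1, (t^2 - 1/3) * √(1 - x*t^2)^P ≤ - ((1/2)^P/576) * x := by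
  set G := √(1 - x/3)^P with hG
  have hanti : ∀ u v : ℝ, u ≤ v → √(1 - x*v)^P ≤ √(1-x*u)^P := by
    intro u v h
    gcongr
  have e1 : ∫ t in (0:ℝ)..1, (t^2 - 1/3) * G = 0 := by
    rw [intervalIntegral.integral_mul_const, intervalIntegral.integral_sub (Continuous.intervalIntegrable (by fun_prop) _ _) (by simp)]
    simp; norm_num
  have c1 : Continuous fun t : ℝ => (t^2 - 1/3) * √(1 - x*t^2)^P := by fun_prop
  have c2 : Continuous fun t : ℝ => (t^2 - 1/3) * G := by fun_prop
  have c3 : Continuous fun t : ℝ => (t^2 - 1/3) * (√(1 - x*t^2)^P - G) := by fun_prop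
  have e2 : ∫ t in (0:ℝ)..1, (t^2 - 1/3) * √(1 - x*t^2)^P
      = ∫ t in (0:ℝ)..1, (t^2 - 1/3) * (√(1 - x*t^2)^P - G) := by
    have e3 := intervalIntegral.integral_sub (μ := volume)
      (c1.intervalIntegrable 0 1) (c2.intervalIntegrable 0 1)
    rw [e1, sub_zero] at e3
    rw [← e3]
    congr 1; ext t; ring
  rw [e2, ← intervalIntegral.integral_add_adjacent_intervals (c3.intervalIntegrable 0 (1/2))
    (c3.intervalIntegrable _ _)]
  have p2 : ∫ t in (1/2:ℝ)..1, (t^2 - 1/3) * (√(1 - x*t^2)^P - G) ≤ 0 := by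
    have : ∫ t in (1/2:ℝ)..1, (t^2 - 1/3) * (√(1 - x*t^2)^P - G) ≤ ∫ t in (1/2:ℝ)..1, (0:ℝ) := by
      apply intervalIntegral.integral_mono_on (by norm_num) (c3.intervalIntegrable _ _) (by simp)
      intro t ht
      rcases le_total (t^2) (1/3) with h | h
      · have := hanti _ _ h
        apply mul_nonpos_of_nonpos_of_nonneg (by linarith)
        rw [hG, div_eq_mul_one_div]; linarith
      · have := hanti _ _ h
        apply mul_nonpos_of_nonneg_of_nonpos (by linarith)
        rw [hG, div_eq_mul_one_div]; linarith
    simpa using this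
  have p1 : ∫ t in (0:ℝ)..(1/2), (t^2 - 1/3) * (√(1 - x*t^2)^P - G)
      ≤ ∫ t in (0:ℝ)..(1/2), - ((1/2)^P/288 * x) := by
    apply intervalIntegral.integral_mono_on (by norm_num) (c3.intervalIntegrable _ _) (by simp)
    intro t ht
    have ht2 : t^2 ≤ 1/4 := by nlinarith [ht.1, ht.2]
    have h1 := hanti _ _ ht2
    set A := √(1 - x*(1/4)) with hA
    set B := √(1 - x/3) with hB
    have hA2 : A^2 = 1 - x*(1/4) := Real.sq_sqrt (by linarith)
    have hB2 : B^2 = 1 - x/3 := Real.sq_sqrt (by linarith)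
    have hA0 : 0 ≤ A := Real.sqrt_nonneg _
    have hB0 : 0 ≤ B := Real.sqrt_nonneg _
    have hAB : B ≤ A := Real.sqrt_le_sqrt (by linarith)
    have hA1 : A ≤ 1 := by nlinarith
    have hAh : 1/2 ≤ A := by nlinarith
    have hd : x/24 ≤ A - B := by nlinarith
    obtain ⟨k, rfl⟩ : ∃ k, P = k+1 := ⟨P-1, by omega⟩
    have h2 : (A - B) * A^k ≤ A^(k+1) - B^(k+1) := by
      have := pow_le_pow_left₀ hB0 hAB k
      have := mul_le_mul_of_nonneg_left this hB0
      rw [pow_succ, pow_succ]; nlinarith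
    have h3 : (1/2:ℝ)^k ≤ A^k := pow_le_pow_left₀ (by norm_num) hAh k
    have h4 : (1/2:ℝ)^(k+1) ≤ (1/2)^k := by
      rw [pow_succ]; nlinarith [show (0:ℝ) ≤ (1/2)^k by positivity]
    have h5 : x/24 * (1/2:ℝ)^(k+1) ≤ (A - B) * A^k :=
      mul_le_mul hd (h4.trans h3) (by positivity) (by linarith)
    have h6 : x/24 * (1/2:ℝ)^(k+1) ≤ √(1 - x*t^2)^(k+1) - G := by linarith
    have h7 : 0 ≤ x/24 * (1/2:ℝ)^(k+1) := by positivity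
    nlinarith
  have e3 : ∫ t in (0:ℝ)..(1/2), - ((1/2)^P/288 * x) = - ((1/2)^P/576) * x := by
    simp; ring
  linarith

lemma bp_scale (P : ℕ) (hP : 1 ≤ P) (τ : ℝ) (x : ℝ) (hx1 : 1 ≤ x)
    (h : ∫ t in (0:ℝ)..1, (t^2 - τ) * √(1 - t^2)^P ≤ 0) :
    ∫ t in (0:ℝ)..1, (t^2 - τ) * √(1 - x*t^2)^P ≤ 0 := by
  have hc : 1 ≤ √x := Real.one_le_sqrt.2 hx1
  have hc2 : √x^2 = x := Real.sq_sqrt (by linarith)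
  set c := √x
  have hc0 : c ≠ 0 := by positivity
  have e1 : ∀ t : ℝ, (t^2 - τ) * √(1 - x*t^2)^P
      = (fun v : ℝ => (v^2/x - τ) * √(1 - v^2)^P) (c * t) := by
    intro t; simp only [mul_pow, hc2]
    rw [mul_div_cancel_left₀ _ (by linarith : x ≠ 0)]
  have e2 : ∫ t in (0:ℝ)..1, (t^2 - τ) * √(1 - x*t^2)^P
      = c⁻¹ • ∫ v in (c*0)..(c*1), (v^2/x - τ) * √(1 - v^2)^P := by
    rw [← intervalIntegral.integral_comp_mul_left _ hc0]
    exact intervalIntegral.integral_congr fun t _ => e1 t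
  rw [e2]
  have c1 : Continuous fun v : ℝ => (v^2/x - τ) * √(1 - v^2)^P := by fun_prop
  have c2 : Continuous fun v : ℝ => (v^2 - τ) * √(1 - v^2)^P := by fun_prop
  rw [mul_zero, mul_one, ← intervalIntegral.integral_add_adjacent_intervals
    (c1.intervalIntegrable 0 1) (c1.intervalIntegrable 1 c)]
  have z : ∫ v in (1:ℝ)..c, (v^2/x - τ) * √(1 - v^2)^P = ∫ v in (1:ℝ)..c, 0 := by
    apply intervalIntegral.integral_congr
    intro v hv
    rw [uIcc_of_le hc] at hv
    simp only
    rw [Real.sqrt_eq_zero_of_nonpos (by nlinarith [hv.1]), zero_pow (by omega), mul_zero]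
  rw [z, intervalIntegral.integral_zero, add_zero]
  have m : ∫ v in (0:ℝ)..1, (v^2/x - τ) * √(1 - v^2)^P
      ≤ ∫ v in (0:ℝ)..1, (v^2 - τ) * √(1 - v^2)^P := by
    apply intervalIntegral.integral_mono_on (by norm_num) (c1.intervalIntegrable _ _)
      (c2.intervalIntegrable _ _)
    intro v hv
    have : v^2/x ≤ v^2 := div_le_self (by positivity) hx1
    gcongr
  have : 0 ≤ c⁻¹ := by positivity
  simp only [smul_eq_mul]
  nlinarith

set_option maxHeartbeats 1000000 in
lemma bp_oneD (P : ℕ) (hP : 1 ≤ P) : ∃ ε τ η : ℝ, 0 < ε ∧ ε < 1 ∧ 0 < τ ∧ 0 < η ∧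
    (∀ x : ℝ, 0 ≤ x → ∫ t in (0:ℝ)..1, √(1 - x*t^2)^(P+2)
      ≤ ∫ t in (0:ℝ)..(1+η), √(1 + ε*τ - (ε + x)*t^2)^(P+2)) ∧
    ∫ t in (0:ℝ)..(1+η), √(1 + ε*τ - ε*t^2)^(P+3) < 1 := by
  obtain ⟨κ, hκ⟩ : ∃ κ : ℝ, κ = (1/2)^P/576 := ⟨_, rfl⟩
  obtain ⟨M, hM⟩ : ∃ M : ℝ, M = P + 2 := ⟨_, rfl⟩
  have hP' : (1:ℝ) ≤ P := by exact_mod_cast hP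
  have hM3 : 3 ≤ M := by linarith
  have hκ0 : 0 < κ := by rw [hκ]; positivity
  have hκ1 : κ ≤ 1/576 := by
    rw [hκ]; have : (1/2:ℝ)^P ≤ 1 := pow_le_one₀ (by norm_num) (by norm_num)
    linarith
  obtain ⟨δ, hδ⟩ : ∃ δ : ℝ, δ = κ/(M+1) := ⟨_, rfl⟩
  have hδ0 : 0 < δ := by rw [hδ]; positivity
  have hδM : δ * (M+1) = κ := by rw [hδ]; field_simp
  have hδκ : δ ≤ κ/4 := by nlinarith
  obtain ⟨ε, hε⟩ : ∃ ε : ℝ, ε = δ/(2*(M+1)^2) := ⟨_, rfl⟩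
  have hε0 : 0 < ε := by rw [hε]; positivity
  have hεM : ε * (M+1)^2 = δ/2 := by rw [hε]; field_simp
  have hεM1 : ε * (M+1) ≤ δ/8 := by nlinarith
  have hε1 : ε ≤ δ/8 := by nlinarith
  obtain ⟨η, hη⟩ : ∃ η : ℝ, η = ε*δ*(M/2+1/4) := ⟨_, rfl⟩
  have hη0 : 0 < η := by rw [hη]; positivity
  have hη1 : η ≤ 1/8 := by
    have : ε * (M/2+1/4) ≤ 1 := by nlinarith
    have := mul_le_mul_of_nonneg_left this hδ0.le
    rw [hη]; nlinarith
  obtain ⟨τ, hτ⟩ : ∃ τ : ℝ, τ = 1/3 - δ := ⟨_, rfl⟩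
  have hτ0 : 0 < τ := by linarith
  have main : ∀ x : ℝ, 0 ≤ x → x ≤ 1 →
      ∫ t in (0:ℝ)..1, (t^2 - τ) * √(1 - x*t^2)^P ≤ δ - κ*x := by
    intro x hx hx1
    have h1 := bp_kappa P hP x hx hx1
    rw [← hκ] at h1
    have c1 : Continuous fun t : ℝ => (t^2 - 1/3) * √(1 - x*t^2)^P := by fun_prop
    have c2 : Continuous fun t : ℝ => √(1 - x*t^2)^P := by fun_prop
    have e : ∫ t in (0:ℝ)..1, (t^2 - τ) * √(1 - x*t^2)^P
        = (∫ t in (0:ℝ)..1, (t^2 - 1/3) * √(1 - x*t^2)^P)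
          + δ * ∫ t in (0:ℝ)..1, √(1 - x*t^2)^P := by
      rw [← intervalIntegral.integral_const_mul, ← intervalIntegral.integral_add
        (c1.intervalIntegrable _ _) ((c2.const_mul δ |>.intervalIntegrable _ _))]
      congr 1; ext t; rw [hτ]; ring
    have : ∫ t in (0:ℝ)..1, √(1 - x*t^2)^P ≤ ∫ t in (0:ℝ)..1, (1:ℝ) := by
      apply intervalIntegral.integral_mono_on (by norm_num) (c2.intervalIntegrable _ _) (by simp)
      intro t _
      apply pow_le_one₀ (Real.sqrt_nonneg _)
      apply Real.sqrt_le_one.2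
      nlinarith [sq_nonneg t, mul_nonneg hx (sq_nonneg t)]
    simp at this
    rw [e]; nlinarith
  have tang : ∀ x : ℝ, (∫ t in (0:ℝ)..1, √(1 - x*t^2)^(P+2))
      - M/2*ε*(∫ t in (0:ℝ)..1, (t^2 - τ) * √(1 - x*t^2)^P)
      ≤ ∫ t in (0:ℝ)..1, √(1 + ε*τ - (ε + x)*t^2)^(P+2) := by
    intro x
    rw [← intervalIntegral.integral_const_mul, ← intervalIntegral.integral_sub
      (Continuous.intervalIntegrable (by fun_prop) _ _)
      (Continuous.intervalIntegrable (by fun_prop) _ _)]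
    apply intervalIntegral.integral_mono_on (by norm_num)
      (Continuous.intervalIntegrable (by fun_prop) _ _)
      (Continuous.intervalIntegrable (by fun_prop) _ _)
    intro t _
    have := bp_tangent (1 + ε*τ - (ε + x)*t^2) (1 - x*t^2) P hP
    rw [hM]
    refine le_trans (le_of_eq ?_) this
    ring
  have split : ∀ (x : ℝ) (k : ℕ), ∫ t in (0:ℝ)..(1+η), √(1 + ε*τ - (ε + x)*t^2)^k
      = (∫ t in (0:ℝ)..1, √(1 + ε*τ - (ε + x)*t^2)^k)
        + ∫ t in (1:ℝ)..(1+η), √(1 + ε*τ - (ε + x)*t^2)^k := by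
    intro x k
    rw [intervalIntegral.integral_add_adjacent_intervals
      (Continuous.intervalIntegrable (by fun_prop) _ _)
      (Continuous.intervalIntegrable (by fun_prop) _ _)]
  have end0 : ∀ x : ℝ, 0 ≤ ∫ t in (1:ℝ)..(1+η), √(1 + ε*τ - (ε + x)*t^2)^(P+2) := by
    intro x
    apply intervalIntegral.integral_nonneg (by linarith)
    intro t _; positivity
  refine ⟨ε, τ, η, hε0, by linarith, hτ0, hη0, ?_, ?_⟩
  · intro x hx
    rw [split]
    have hMε : 0 ≤ M/2*ε := by positivity
    rcases le_total 1 x with hx1 | hx1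
    · have := main 1 (by norm_num) le_rfl
      simp only [one_mul] at this
      have := bp_scale P hP τ x hx1 (by linarith)
      nlinarith [tang x, end0 x]
    · have h1 := main x hx hx1
      have h2 := mul_le_mul_of_nonneg_left h1 hMε
      rcases le_total (δ - κ*x) 0 with h | h
      · nlinarith [tang x, end0 x]
      · have h3 : η * (1 - M*(ε+x)) ≤ ∫ t in (1:ℝ)..(1+η), √(1 + ε*τ - (ε + x)*t^2)^(P+2) := by
          have : ∫ t in (1:ℝ)..(1+η), (1 - M*(ε+x))
              ≤ ∫ t in (1:ℝ)..(1+η), √(1 + ε*τ - (ε + x)*t^2)^(P+2) := by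
            apply intervalIntegral.integral_mono_on (by linarith) (by simp)
              (Continuous.intervalIntegrable (by fun_prop) _ _)
            intro t ht
            have := bp_tangent (1 + ε*τ - (ε + x)*t^2) 1 P hP
            simp at this
            rw [← hM] at this
            refine le_trans ?_ this
            have ht2 : t^2 ≤ 2 := by nlinarith [ht.1, ht.2]
            have h5 : (ε+x)*t^2 ≤ (ε+x)*2 := mul_le_mul_of_nonneg_left ht2 (by linarith)
            have h6 : 0 < ε*τ := by positivity
            have h7 : -(2*(ε+x)) ≤ 1 + ε*τ - (ε + x)*t^2 - 1 := by linarith only [h5, h6]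
            have h8 := mul_le_mul_of_nonneg_left h7 (show 0 ≤ M/2 by linarith only [hM3])
            linarith only [h8]
          rw [intervalIntegral.integral_const, smul_eq_mul] at this
          linarith only [this]
        have h4 : M/2*ε*(δ - κ*x) ≤ η * (1 - M*(ε+x)) := by
          rw [hη]
          have : M/2*(δ - κ*x) ≤ δ*(M/2+1/4) * (1 - M*(ε+x)) := by
            have a1 : (M/2+1/4)*M*ε ≤ 1/4 := by
              have : (M/2+1/4)*M ≤ (M+1)^2 := by nlinarith only [hM3]
              have := mul_le_mul_of_nonneg_left this hε0.le
              nlinarith only [this, hεM, hδκ, hκ1]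
            have a2 : M*δ*(M/2+1/4) ≤ M/2*κ := by
              rw [← hδM]
              have : 0 ≤ M*δ := by positivity
              nlinarith only [this]
            have a3 := mul_le_mul_of_nonneg_left a1 hδ0.le
            have a4 := mul_le_mul_of_nonneg_right a2 hx
            nlinarith only [a3, a4]
          have := mul_le_mul_of_nonneg_left this hε0.le
          linarith only [this]
        linarith [tang x]
  · have s := split 0 (P+3)
    simp only [add_zero] at s
    rw [s]
    have b2 : ∫ t in (1:ℝ)..(1+η), √(1 + ε*τ - ε*t^2)^(P+3) ≤ η := by
      have : ∫ t in (1:ℝ)..(1+η), √(1 + ε*τ - ε*t^2)^(P+3) ≤ ∫ t in (1:ℝ)..(1+η), (1:ℝ) := by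
        apply intervalIntegral.integral_mono_on (by linarith)
          (Continuous.intervalIntegrable (by fun_prop) _ _) (by simp)
        intro t ht
        apply pow_le_one₀ (Real.sqrt_nonneg _)
        apply Real.sqrt_le_one.2
        have : τ ≤ t^2 := by nlinarith [ht.1]
        nlinarith
      simpa using this
    set S : ℝ := (M+1)/2 with hS
    have b1 : ∫ t in (0:ℝ)..1, √(1 + ε*τ - ε*t^2)^(P+3)
        ≤ ∫ t in (0:ℝ)..1, (1 + S^2*ε^2 + S*ε*τ - S*ε*t^2) := by
      apply intervalIntegral.integral_mono_on (by norm_num)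
        (Continuous.intervalIntegrable (by fun_prop) _ _)
        (Continuous.intervalIntegrable (by fun_prop) _ _)
      intro t ht
      set z := ε*(τ - t^2) with hz
      have hw : |τ - t^2| ≤ 1 := by
        rw [abs_le]; constructor <;> nlinarith [ht.1, ht.2]
      have hzε : |z| ≤ ε := by
        rw [hz, abs_mul, abs_of_pos hε0]; nlinarith
      have hS0 : 0 < S := by rw [hS]; positivity
      have hSz : |S*z| ≤ S*ε := by
        rw [abs_mul, abs_of_pos hS0]; gcongr
      have hSε : S*ε ≤ 1 := by rw [hS]; nlinarith
      have k1 : √(1 + ε*τ - ε*t^2) ≤ Real.exp (z/2) := by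
        rw [Real.sqrt_le_left (Real.exp_nonneg _), ← Real.exp_nat_mul]
        have := Real.add_one_le_exp z
        have e : ((2:ℕ):ℝ) * (z/2) = z := by push_cast; ring
        rw [e]; rw [hz] at *; linarith
      have k2 : √(1 + ε*τ - ε*t^2)^(P+3) ≤ Real.exp (S*z) := by
        refine (pow_le_pow_left₀ (Real.sqrt_nonneg _) k1 _).trans (le_of_eq ?_)
        rw [← Real.exp_nat_mul]
        congr 1; push_cast; rw [hS, hM]; ring
      have k3 := (abs_le.1 (Real.abs_exp_sub_one_sub_id_le (hSz.trans hSε))).2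
      have k4 : (S*z)^2 ≤ (S*ε)^2 := sq_le_sq' (by linarith [(abs_le.1 hSz).1]) (abs_le.1 hSz).2
      rw [hz] at *
      nlinarith only [k2, k3, k4]
    have b3 : ∫ t in (0:ℝ)..1, (1 + S^2*ε^2 + S*ε*τ - S*ε*t^2)
        = 1 + S^2*ε^2 + S*ε*τ - S*ε/3 := by
      rw [intervalIntegral.integral_sub (by simp) (Continuous.intervalIntegrable (by fun_prop) _ _)]
      simp; ring
    have b4 : S^2*ε^2 = δ*ε/8 := by
      have : S^2*ε^2 = ε * (ε * (M+1)^2)/4 := by rw [hS]; ring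
      rw [this, hεM]; ring
    have b5 : 0 < δ*ε := by positivity
    rw [b3, b4, hS] at b1
    have b6 : (M+1)/2*ε*τ = (M+1)/2*ε/3 - (M+1)/2*ε*δ := by rw [hτ]; ring
    nlinarith only [b1, b2, b5, b6, hη]

lemma bp_even (f : ℝ → ℝ) (hf : Continuous f) (he : ∀ t, f (-t) = f t) (a : ℝ) :
    ∫ t in (-a)..a, f t = 2 * ∫ t in (0:ℝ)..a, f t := by
  rw [← intervalIntegral.integral_add_adjacent_intervals (hf.intervalIntegrable (-a) 0)
    (hf.intervalIntegrable 0 a)]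
  have : ∫ t in (-a)..0, f t = ∫ t in (0:ℝ)..a, f t := by
    have h := intervalIntegral.integral_comp_neg (a := 0) (b := a) f
    simp only [he, neg_zero] at h
    exact h.symm
  rw [this]; ring

lemma bp_ball (d : ℕ) (hd : 1 ≤ d) : ∃ C : ℝ≥0∞, C ≠ 0 ∧ C ≠ ⊤ ∧ ∀ ρ : ℝ,
    volume {w : Fin d → ℝ | ∑ i, w i ^ 2 ≤ ρ} = C * ENNReal.ofReal (√ρ ^ d) := by
  refine ⟨volume (Metric.ball (0 : EuclideanSpace ℝ (Fin d)) 1),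
    (Metric.measure_ball_pos _ _ one_pos).ne', measure_ball_lt_top.ne, fun ρ => ?_⟩
  have hm : MeasurableSet {w : Fin d → ℝ | ∑ i, w i ^ 2 ≤ ρ} :=
    measurableSet_le (by fun_prop) (by fun_prop)
  rw [← (PiLp.volume_preserving_ofLp (Fin d)).measure_preimage hm.nullMeasurableSet]
  rcases lt_or_ge ρ 0 with h | h
  · have : (WithLp.ofLp (p := 2) ⁻¹' {w : Fin d → ℝ | ∑ i, w i ^ 2 ≤ ρ}) = ∅ := by
      ext w
      simp only [mem_preimage, mem_ofPred_eq, mem_empty_iff_false, iff_false, not_le]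
      exact h.trans_le (Finset.sum_nonneg fun i _ => sq_nonneg _)
    rw [this, Real.sqrt_eq_zero_of_nonpos h.le, zero_pow (by omega)]
    simp
  · have : (WithLp.ofLp (p := 2) ⁻¹' {w : Fin d → ℝ | ∑ i, w i ^ 2 ≤ ρ})
        = Metric.closedBall (0 : EuclideanSpace ℝ (Fin d)) (√ρ) := by
      ext w
      simp only [mem_preimage, mem_ofPred_eq, mem_closedBall_zero_iff]
      rw [Real.le_sqrt (norm_nonneg _) h, EuclideanSpace.norm_sq_eq]
      simp
    rw [this, Measure.addHaar_closedBall _ _ (Real.sqrt_nonneg _), mul_comm]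
    simp

lemma bp_slab (d : ℕ) (hd : 1 ≤ d) : ∃ C : ℝ≥0∞, C ≠ 0 ∧ C ≠ ⊤ ∧ ∀ a β γ ρ : ℝ, 0 < a → β ≠ 0 →
    volume {z : EuclideanSpace ℝ (Fin (d+1)) | |β * z 0| ≤ a ∧ ‖z‖^2 - γ * z 0 ^ 2 ≤ ρ}
      = C * ENNReal.ofReal (2 / |β| * ∫ t in (0:ℝ)..a, √(ρ - (1-γ)/β^2 * t^2)^d) := by
  obtain ⟨C, hC0, hCt, hC⟩ := bp_ball d hd
  refine ⟨C, hC0, hCt, fun a β γ ρ ha hβ => ?_⟩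
  have hβ' : 0 < |β| := abs_pos.2 hβ
  let T : Set (ℝ × (Fin d → ℝ)) := {p | |β * p.1| ≤ a ∧ ∑ i, p.2 i ^ 2 ≤ ρ - (1-γ)*p.1^2}
  have hT : MeasurableSet T := by
    have h1 : MeasurableSet {p : ℝ × (Fin d → ℝ) | |β * p.1| ≤ a} :=
      measurableSet_le (by fun_prop) (by fun_prop)
    have h2 : MeasurableSet {p : ℝ × (Fin d → ℝ) | ∑ i, p.2 i ^ 2 ≤ ρ - (1-γ)*p.1^2} :=
      measurableSet_le (by fun_prop) (by fun_prop)
    exact h1.inter h2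
  have mp := (volume_preserving_piFinSuccAbove (fun _ : Fin (d+1) => ℝ) 0).comp
    (PiLp.volume_preserving_ofLp (Fin (d+1)))
  have e1 : {z : EuclideanSpace ℝ (Fin (d+1)) | |β * z 0| ≤ a ∧ ‖z‖^2 - γ * z 0 ^ 2 ≤ ρ}
      = ((MeasurableEquiv.piFinSuccAbove (fun _ : Fin (d+1) => ℝ) 0) ∘ WithLp.ofLp (p := 2)) ⁻¹' T := by
    ext z
    simp only [T, mem_ofPred_eq, mem_preimage, Function.comp, MeasurableEquiv.piFinSuccAbove_apply,
      Fin.insertNthEquiv_symm_apply, EuclideanSpace.norm_sq_eq, Fin.sum_univ_succ, Real.norm_eq_abs, sq_abs,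
      Fin.removeNth, Fin.zero_succAbove]
    refine and_congr_right fun _ => ⟨fun h => by linarith, fun h => by linarith⟩
  rw [e1, mp.measure_preimage hT.nullMeasurableSet, Measure.volume_eq_prod, Measure.prod_apply hT]
  have hc : Continuous fun s : ℝ => √(ρ - (1-γ)*s^2)^d := by fun_prop
  have e2 : ∀ s : ℝ, volume (Prod.mk s ⁻¹' T)
      = (Icc (-(a/|β|)) (a/|β|)).indicator (fun s => C * ENNReal.ofReal (√(ρ - (1-γ)*s^2)^d)) s := by
    intro s
    have hs : s ∈ Icc (-(a/|β|)) (a/|β|) ↔ |β * s| ≤ a := by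
      rw [mem_Icc, ← abs_le, le_div_iff₀ hβ', abs_mul, mul_comm]
    by_cases h : |β * s| ≤ a
    · rw [indicator_of_mem (hs.2 h), ← hC]
      congr 1; ext w; simp only [T, h, mem_preimage, mem_ofPred_eq, true_and, false_and, mem_empty_iff_false]
    · rw [indicator_of_notMem (fun h' => h (hs.1 h'))]
      convert measure_empty (μ := (volume : Measure (Fin d → ℝ)))
      ext w; simp only [T, h, mem_preimage, mem_ofPred_eq, true_and, false_and, mem_empty_iff_false]
  simp_rw [e2]
  rw [lintegral_indicator measurableSet_Icc, lintegral_const_mul _ (by fun_prop)]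
  congr 1
  rw [← ofReal_integral_eq_lintegral_ofReal (hc.integrableOn_Icc) (ae_of_all _ fun s => by positivity)]
  congr 1
  have ha' : 0 < a/|β| := by positivity
  rw [integral_Icc_eq_integral_Ioc, ← intervalIntegral.integral_of_le (by linarith),
    bp_even _ hc (fun t => by simp)]
  have e3 : ∫ s in (0:ℝ)..(a/|β|), √(ρ - (1-γ)*s^2)^d
      = |β|⁻¹ • ∫ t in (|β| * 0)..(|β| * (a / |β|)), √(ρ - (1-γ)/β^2 * t^2)^d := by
    rw [← intervalIntegral.integral_comp_mul_left _ hβ'.ne']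
    refine intervalIntegral.integral_congr fun s _ => ?_
    simp only [mul_pow, sq_abs]
    rw [← mul_assoc, div_mul_cancel₀ _ (by positivity)]
  rw [e3, mul_zero, mul_div_cancel₀ _ hβ'.ne']
  simp only [smul_eq_mul]; ring

lemma bp_basis (m : ℕ) (e ξ : EuclideanSpace ℝ (Fin (m+2))) (hξ : ‖ξ‖ = 1) :
    ∃ b : OrthonormalBasis (Fin (m+2)) ℝ (EuclideanSpace ℝ (Fin (m+2))),
      b 0 = ξ ∧ ∀ i : Fin m, ⟪b i.succ.succ, e⟫ = 0 := by
  set w := e - ⟪ξ, e⟫ • ξ with hw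
  have hξξ : ⟪ξ, ξ⟫ = 1 := by rw [real_inner_self_eq_norm_sq, hξ]; norm_num
  have hξw : ⟪ξ, w⟫ = 0 := by
    rw [hw, inner_sub_right, inner_smul_right, hξξ]; ring
  have he : e = w + ⟪ξ, e⟫ • ξ := by rw [hw]; abel
  by_cases h0 : w = 0
  · obtain ⟨b, hb⟩ := Orthonormal.exists_orthonormalBasis_extension_of_card_eq (𝕜 := ℝ)
      (E := EuclideanSpace ℝ (Fin (m+2))) (ι := Fin (m+2)) (by simp) (v := fun _ => ξ) (s := {0}) (by
        rw [orthonormal_iff_ite]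
        rintro ⟨i, hi⟩ ⟨j, hj⟩
        simp only [mem_singleton_iff] at hi hj
        subst hi; subst hj
        simp [hξ])
    refine ⟨b, hb 0 rfl, fun i => ?_⟩
    rw [he, h0, zero_add, inner_smul_right, ← hb 0 rfl, b.inner_eq_zero (Fin.succ_ne_zero _), mul_zero]
  · have hn : ‖w‖ ≠ 0 := norm_ne_zero_iff.2 h0
    obtain ⟨b, hb⟩ := Orthonormal.exists_orthonormalBasis_extension_of_card_eq (𝕜 := ℝ)
      (E := EuclideanSpace ℝ (Fin (m+2))) (ι := Fin (m+2)) (by simp)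
      (v := fun i => if i = 0 then ξ else ‖w‖⁻¹ • w) (s := {0, 1}) (by
        have hww : ⟪w, w⟫ = ‖w‖^2 := real_inner_self_eq_norm_sq w
        have hwξ : ⟪w, ξ⟫ = 0 := by rw [real_inner_comm, hξw]
        rw [orthonormal_iff_ite]
        rintro ⟨i, hi⟩ ⟨j, hj⟩
        simp only [mem_singleton_iff, mem_insert_iff] at hi hj
        rcases hi with rfl | rfl <;> rcases hj with rfl | rfl <;>
          simp [hξ, inner_smul_left, inner_smul_right, hξw, hwξ]
        rw [norm_smul]; left; simp [hn])
    have h1 : b 0 = ξ := by simpa using hb 0 (by simp)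
    have h2 : b 1 = ‖w‖⁻¹ • w := by simpa using hb 1 (by simp)
    have h3 : w = ‖w‖ • b 1 := by rw [h2, smul_smul, mul_inv_cancel₀ hn, one_smul]
    refine ⟨b, h1, fun i => ?_⟩
    rw [he, h3, ← h1, inner_add_right, inner_smul_right, inner_smul_right,
      b.inner_eq_zero (Fin.succ_ne_zero _), b.inner_eq_zero (by
        rw [← Fin.succ_zero_eq_one]; exact fun h => Fin.succ_ne_zero _ (Fin.succ_injective _ h))]
    ring

def bpBody (m : ℕ) (a γ ρ : ℝ) : Set (EuclideanSpace ℝ (Fin (m+2))) :=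
  {x | |x 0| ≤ a ∧ ‖x‖^2 - γ * x 0 ^ 2 ≤ ρ}

lemma bp_coord {m : ℕ} (x : EuclideanSpace ℝ (Fin (m+2))) : x 0 ^ 2 ≤ ‖x‖^2 := by
  rw [EuclideanSpace.norm_sq_eq]
  have := Finset.single_le_sum (f := fun i => ‖x i‖^2) (fun i _ => by positivity)
    (Finset.mem_univ (0 : Fin (m+2)))
  simpa using this

lemma bpBody_props (m : ℕ) (a γ ρ : ℝ) (ha : 0 < a) (hγ0 : 0 ≤ γ) (hγ : γ ≤ 1) (hρ : 0 < ρ) :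
    IsCompact (bpBody m a γ ρ) ∧ Convex ℝ (bpBody m a γ ρ) ∧ (interior (bpBody m a γ ρ)).Nonempty
      ∧ bpBody m a γ ρ = - bpBody m a γ ρ := by
  have c1 : Continuous fun x : EuclideanSpace ℝ (Fin (m+2)) => |x 0| := by fun_prop
  have c2 : Continuous fun x : EuclideanSpace ℝ (Fin (m+2)) => ‖x‖^2 - γ * x 0 ^ 2 := by fun_prop
  refine ⟨?_, ?_, ?_, ?_⟩
  · apply Metric.isCompact_of_isClosed_isBounded
    · exact (isClosed_le c1 continuous_const).inter (isClosed_le c2 continuous_const)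
    · rw [isBounded_iff_forall_norm_le]
      refine ⟨√(ρ + γ * a^2), fun x hx => Real.le_sqrt_of_sq_le ?_⟩
      have h1 : x 0 ^ 2 ≤ a^2 := by rw [← sq_abs]; exact pow_le_pow_left₀ (abs_nonneg _) hx.1 2
      have h2 := mul_le_mul_of_nonneg_left h1 hγ0
      linarith [hx.2]
  · rw [convex_iff_forall_pos]
    intro x hx y hy s t hs ht hst
    have h0 : (s • x + t • y) 0 = s * x 0 + t * y 0 := by simp
    refine ⟨?_, ?_⟩
    · rw [h0]
      calc |s * x 0 + t * y 0| ≤ |s * x 0| + |t * y 0| := abs_add_le _ _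
        _ = s * |x 0| + t * |y 0| := by rw [abs_mul, abs_mul, abs_of_pos hs, abs_of_pos ht]
        _ ≤ s * a + t * a := by gcongr; exacts [hx.1, hy.1]
        _ = a := by rw [← add_mul, hst, one_mul]
    · rw [h0]
      have n1 : ‖s • x + t • y‖^2 = s^2*‖x‖^2 + 2*s*t*⟪x, y⟫ + t^2*‖y‖^2 := by
        rw [norm_add_sq_real, norm_smul, norm_smul, inner_smul_left, inner_smul_right]
        simp only [Real.norm_eq_abs, mul_pow, sq_abs]; simp; ring
      have n2 : ‖x - y‖^2 = ‖x‖^2 - 2*⟪x,y⟫ + ‖y‖^2 := norm_sub_sq_real x y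
      have n3 : (x - y) 0 = x 0 - y 0 := by simp
      have n4 := bp_coord (x - y)
      rw [n3, n2] at n4
      have n5 : 0 ≤ ‖x‖^2 - 2*⟪x,y⟫ + ‖y‖^2 - γ * (x 0 - y 0)^2 := by
        nlinarith only [n4, hγ, sq_nonneg (x 0 - y 0)]
      have n6 := mul_nonneg (mul_pos hs ht).le n5
      have hx2 := mul_le_mul_of_nonneg_left hx.2 hs.le
      have hy2 := mul_le_mul_of_nonneg_left hy.2 ht.le
      rw [n1]
      obtain rfl : t = 1 - s := by linarith
      nlinarith only [n6, hx2, hy2]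
  · have ho : IsOpen ({x : EuclideanSpace ℝ (Fin (m+2)) | |x 0| < a} ∩ {x | ‖x‖^2 - γ * x 0 ^ 2 < ρ}) :=
      (isOpen_lt c1 continuous_const).inter (isOpen_lt c2 continuous_const)
    refine ⟨0, interior_maximal (show _ ⊆ bpBody m a γ ρ from fun x hx => ⟨le_of_lt hx.1, le_of_lt hx.2⟩) ho ⟨?_, ?_⟩⟩
    · simpa using ha
    · simpa using hρ
  · ext x
    simp [bpBody]

lemma bp_section (m : ℕ) (ξ : EuclideanSpace ℝ (Fin (m+2))) (hξ : ‖ξ‖ = 1) :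
    ∃ β : ℝ, β^2 ≤ 1 ∧ ∃ c : ℝ≥0∞, ∀ a γ ρ : ℝ,
      μH[((m+2 : ℕ) : ℝ) - 1] (bpBody m a γ ρ ∩ {x | ⟪x, ξ⟫ = 0})
        = c * volume {z : EuclideanSpace ℝ (Fin (m+1)) |
            |β * z 0| ≤ a ∧ ‖z‖^2 - (γ * β^2) * z 0 ^ 2 ≤ ρ} := by
  let e : EuclideanSpace ℝ (Fin (m+2)) := EuclideanSpace.single 0 1
  have hex : ∀ x : EuclideanSpace ℝ (Fin (m+2)), ⟪x, e⟫ = x 0 := by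
    intro x; simp [e, EuclideanSpace.inner_single_right]
  obtain ⟨b, hb0, hb⟩ := bp_basis m e ξ hξ
  have hbs : Orthonormal ℝ (fun i : Fin (m+1) => b i.succ) :=
    b.orthonormal.comp _ (Fin.succ_injective _)
  let ψ : EuclideanSpace ℝ (Fin (m+1)) → EuclideanSpace ℝ (Fin (m+2)) :=
    fun z => ∑ i, z i • b i.succ
  have hψn : ∀ z, ‖ψ z‖^2 = ‖z‖^2 := by
    intro z
    rw [← real_inner_self_eq_norm_sq, hbs.inner_sum, EuclideanSpace.norm_sq_eq]
    simp [sq]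
  have hψi : Isometry ψ := by
    apply Isometry.of_dist_eq
    intro z z'
    rw [dist_eq_norm, dist_eq_norm]
    have : ψ z - ψ z' = ψ (z - z') := by
      simp [ψ, sub_smul, Finset.sum_sub_distrib]
    rw [this]
    exact (sq_eq_sq₀ (norm_nonneg _) (norm_nonneg _)).1 (hψn _)
  have hψ0 : ∀ z, (ψ z) 0 = ⟪b 1, e⟫ * z 0 := by
    intro z
    rw [← hex]
    simp only [ψ, sum_inner, inner_smul_left]
    rw [Fin.sum_univ_succ]
    simp [mul_comm, hb]
  refine ⟨⟪b 1, e⟫, ?_, ?_⟩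
  · have h1 := abs_real_inner_le_norm (b 1) e
    have h2 : ‖e‖ = 1 := by simp [e]
    rw [b.orthonormal.1, h2, one_mul] at h1
    rw [← sq_abs]; exact pow_le_one₀ (abs_nonneg _) h1
  · have hfr : ((m+2 : ℕ) : ℝ) - 1 = (Module.finrank ℝ (EuclideanSpace ℝ (Fin (m+1))) : ℝ) := by
      simp; ring
    let μ : Measure (EuclideanSpace ℝ (Fin (m+1))) :=
      μH[(Module.finrank ℝ (EuclideanSpace ℝ (Fin (m+1))) : ℝ)]
    have hμ := Measure.isAddLeftInvariant_eq_smul μ (volume : Measure (EuclideanSpace ℝ (Fin (m+1))))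
    refine ⟨(Measure.addHaarScalarFactor μ volume : ℝ≥0∞), fun a γ ρ => ?_⟩
    have e1 : bpBody m a γ ρ ∩ {x | ⟪x, ξ⟫ = 0} = ψ '' {z : EuclideanSpace ℝ (Fin (m+1)) |
            |⟪b 1, e⟫ * z 0| ≤ a ∧ ‖z‖^2 - (γ * ⟪b 1, e⟫^2) * z 0 ^ 2 ≤ ρ} := by
      ext x
      constructor
      · rintro ⟨hx, hxξ⟩
        have hx' : ψ (WithLp.toLp 2 fun i => ⟪b i.succ, x⟫) = x := by
          conv_rhs => rw [← b.sum_repr' x]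
          rw [Fin.sum_univ_succ, hb0, real_inner_comm, show ⟪x, ξ⟫ = 0 from hxξ, zero_smul, zero_add]
        refine ⟨_, ?_, hx'⟩
        obtain ⟨h1, h2⟩ := hx
        rw [← hx', hψ0] at h1 h2
        rw [hψn] at h2
        exact ⟨h1, by rw [mul_pow] at h2; linarith⟩
      · rintro ⟨z, ⟨h1, h2⟩, rfl⟩
        refine ⟨⟨by rw [hψ0]; exact h1, by rw [hψ0, hψn, mul_pow]; linarith⟩, ?_⟩
        show ⟪ψ z, ξ⟫ = 0
        rw [← hb0]
        simp only [ψ, sum_inner, inner_smul_left]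
        refine Finset.sum_eq_zero fun i _ => ?_
        rw [b.inner_eq_zero (Fin.succ_ne_zero _), mul_zero]
    rw [e1, hψi.hausdorffMeasure_image (Or.inl (by rw [hfr]; positivity)), hfr]
    change μ _ = _
    have := congrArg (fun ν : Measure (EuclideanSpace ℝ (Fin (m+1))) =>
      ν {z | |⟪b 1, e⟫ * z 0| ≤ a ∧ ‖z‖^2 - (γ * ⟪b 1, e⟫^2) * z 0 ^ 2 ≤ ρ}) hμ
    refine this.trans ?_
    rfl


/-- Negative answer to the Busemann–Petty problem for `n ≥ 5`: there exist
origin-symmetric convex bodies `K` and `L` in `ℝⁿ` such that every central hyperplane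
section of `K` has `(n−1)`-dimensional Hausdorff measure at most that of the
corresponding section of `L`, yet `vol_n(K) > vol_n(L)`. -/
theorem busemann_petty_negative (n : ℕ) (hn : 5 ≤ n) :
    ∃ K L : Set (EuclideanSpace ℝ (Fin n)),
      IsCompact K ∧ Convex ℝ K ∧ (interior K).Nonempty ∧ K = -K ∧
      IsCompact L ∧ Convex ℝ L ∧ (interior L).Nonempty ∧ L = -L ∧
      (∀ ξ : EuclideanSpace ℝ (Fin n), ‖ξ‖ = 1 →
        μH[(n : ℝ) - 1] (K ∩ {x : EuclideanSpace ℝ (Fin n) | ⟪x, ξ⟫ = 0})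
          ≤ μH[(n : ℝ) - 1] (L ∩ {x : EuclideanSpace ℝ (Fin n) | ⟪x, ξ⟫ = 0})) ∧
      volume L < volume K := by
  obtain ⟨P, rfl⟩ : ∃ P, n = P + 2 + 2 := ⟨n - 4, by omega⟩
  have hP : 1 ≤ P := by omega
  obtain ⟨ε, τ, η, hε0, hε1, hτ0, hη0, hsec, hvol⟩ := bp_oneD P hP
  have hετ : 0 < ε * τ := by positivity
  obtain ⟨k1, k2, k3, k4⟩ := bpBody_props (P+2) 1 1 1 one_pos zero_le_one le_rfl one_pos
  obtain ⟨l1, l2, l3, l4⟩ := bpBody_props (P+2) (1+η) (1-ε) (1+ε*τ) (by linarith) (by linarith)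
    (by linarith) (by linarith)
  refine ⟨bpBody (P+2) 1 1 1, bpBody (P+2) (1+η) (1-ε) (1+ε*τ), k1, k2, k3, k4, l1, l2, l3, l4, ?_, ?_⟩
  · intro ξ hξ
    obtain ⟨β, hβ1, c, hc⟩ := bp_section (P+2) ξ hξ
    rw [hc, hc]
    gcongr c * ?_
    by_cases hβ : β = 0
    · apply measure_mono
      rintro z ⟨h1, h2⟩
      rw [hβ] at h2
      constructor
      · rw [hβ]; simp; linarith
      · rw [hβ]; nlinarith only [h2, hετ]
    · obtain ⟨C, _, _, hC⟩ := bp_slab (P+2) (by omega)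
      rw [hC _ _ _ _ one_pos hβ, hC _ _ _ _ (by linarith) hβ]
      gcongr C * ENNReal.ofReal (_ * ?_)
      have hβ2 : 0 < β^2 := by positivity
      have h := hsec ((1 - β^2)/β^2) (div_nonneg (by linarith) hβ2.le)
      have e1 : (1 - (1-ε)*β^2)/β^2 = ε + (1 - β^2)/β^2 := by field_simp; ring
      rw [e1, one_mul]
      exact h
  · obtain ⟨C, hC0, hCt, hC⟩ := bp_slab (P+3) (by omega)
    have hK := hC 1 1 1 1 one_pos one_ne_zero
    have hL := hC (1+η) 1 (1-ε) (1+ε*τ) (by linarith) one_ne_zero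
    simp only [one_mul] at hK hL
    have hK' : volume (bpBody (P+2) 1 1 1) = C * ENNReal.ofReal 2 := by
      refine Eq.trans ?_ (hK.trans ?_)
      · simp only [bpBody, one_mul]
      · simp
    have hL' : volume (bpBody (P+2) (1+η) (1-ε) (1+ε*τ)) = C * ENNReal.ofReal
        (2 * ∫ t in (0:ℝ)..(1+η), √(1 + ε*τ - ε*t^2)^(P+3)) := by
      refine Eq.trans ?_ (hL.trans ?_)
      · simp only [bpBody]
      · simp
    rw [hK', hL']
    apply ENNReal.mul_lt_mul_right hC0 hCt
    rw [ENNReal.ofReal_lt_ofReal_iff (by norm_num)]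
    linarith
end
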